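/- arXiv:1208.1954 — 4 statements merged into one kernel-verified Lean document; each statement's English description precedes it below -/
import Mathlib

section
/- For n = 1 or n = 2, let (U,φ) be an n-dimensional chart in a Lipschitz differentiability space (X,d,μ). Then the pushforward measure φ_*(μ⌞U) is absolutely continuous with respect to n-dimensional Lebesgue measure on ℝⁿ. In particular, if μ(U) > 0 then the n-dimensional Lebesgue measure of φ(U) is positive. -/
open MeasureTheory Metric Filter Set Topology
open scoped ENNReal NNReal

noncomputable section

/-- The euclidean dot product on `ℝⁿ`. -/
def euclDot {n : ℕ} (a b : EuclideanSpace ℝ (Fin n)) : ℝ := ∑ i, a i * b i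

/-- `f` admits `D` as a derivative at `x₀` with respect to the chart map `φ`:
`|f x - f x₀ - D·(φ x - φ x₀)| / d(x,x₀) → 0` as `x → x₀`. -/
def DiffAt {X : Type*} [MetricSpace X] {n : ℕ} (f : X → ℝ)
    (φ : X → EuclideanSpace ℝ (Fin n)) (x₀ : X) (D : EuclideanSpace ℝ (Fin n)) : Prop :=
  Tendsto (fun x => |f x - f x₀ - euclDot D (φ x - φ x₀)| / dist x x₀) (𝓝[≠] x₀) (𝓝 0)

/-- A metric measure space is a Lipschitz differentiability space if it admits a countable
Borel decomposition into charts with respect to which every real-valued Lipschitz function is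
differentiable almost everywhere. -/
def IsLDS (X : Type*) [MetricSpace X] [MeasurableSpace X] (μ : Measure X) : Prop :=
  ∃ (n : ℕ → ℕ) (U : ℕ → Set X) (φ : ∀ i, X → EuclideanSpace ℝ (Fin (n i))),
    (∀ i, MeasurableSet (U i)) ∧ (⋃ i, U i) = univ ∧
    (∀ i, ∃ K : ℝ≥0, LipschitzWith K (φ i)) ∧
    ∀ f : X → ℝ, (∃ K : ℝ≥0, LipschitzWith K f) →
      ∀ i, ∀ᵐ x ∂(μ.restrict (U i)), ∃! D, DiffAt f (φ i) x D

end


open scoped Manifold ContDiff in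
lemma cutoff_exists {E : Type*} [NormedAddCommGroup E] [NormedSpace ℝ E] [FiniteDimensional ℝ E]
    {K O : Set E} (hK : IsCompact K) (hO : IsOpen O) (hKO : K ⊆ O) :
    ∃ χ : E → ℝ, ∃ B : ℝ, 0 < B ∧ ContDiff ℝ 1 χ ∧ (∀ p, 0 ≤ χ p ∧ χ p ≤ 1) ∧
      (∀ p ∈ K, χ p = 1) ∧ (∀ p, ‖fderiv ℝ χ p‖ ≤ B) ∧
      (∀ p, p ∉ O → χ p = 0 ∧ fderiv ℝ χ p = 0) := by
  obtain ⟨R, hR⟩ := hK.isBounded.subset_ball (0 : E)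
  obtain ⟨χ, h0, h1, h01⟩ := exists_contMDiffMap_zero_one_of_isClosed (n := 1) 𝓘(ℝ, E)
    (s := (O ∩ ball (0:E) R)ᶜ) (t := K) (hO.inter isOpen_ball).isClosed_compl hK.isClosed
    (by
      rw [Set.disjoint_left]; intro x hx hxK; exact hx ⟨hKO hxK, hR hxK⟩)
  have hχ : ContDiff ℝ 1 (χ : E → ℝ) := χ.contMDiff.contDiff
  have hz : ∀ p, p ∉ O ∩ ball (0:E) R → χ p = 0 ∧ fderiv ℝ χ p = 0 := by
    intro p hp
    have hp0 : χ p = 0 := h0 hp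
    refine ⟨hp0, ?_⟩
    apply IsLocalMin.fderiv_eq_zero
    exact Eventually.of_forall fun q => by rw [hp0]; exact (h01 q).1
  have hcont : Continuous (fderiv ℝ (χ : E → ℝ)) := hχ.continuous_fderiv (by norm_num)
  obtain ⟨B, hB⟩ := (isCompact_closedBall (0:E) R).exists_bound_of_continuousOn hcont.continuousOn
  refine ⟨χ, max B 1, by positivity, hχ, fun p => ⟨(h01 p).1, (h01 p).2⟩, fun p hp => h1 hp, ?_, ?_⟩
  · intro p
    by_cases hp : p ∈ closedBall (0:E) R
    · exact (hB p hp).trans (le_max_left _ _)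
    · rw [(hz p (fun h => hp (ball_subset_closedBall h.2))).2]; simp
  · intro p hp
    exact hz p (fun h => hp h.1)

/-- gradient of `f + s • χ G`. -/
lemma fderiv_add_cut {E : Type*} [NormedAddCommGroup E] [NormedSpace ℝ E]
    {f χ G : E → ℝ} (hf : ContDiff ℝ 1 f) (hχ : ContDiff ℝ 1 χ) (hG : ContDiff ℝ 1 G) (s : ℝ) (p : E) :
    fderiv ℝ (fun p => f p + s * (χ p * G p)) p =
      fderiv ℝ f p + s • (χ p • fderiv ℝ G p + G p • fderiv ℝ χ p) := by
  have h1 : HasFDerivAt f (fderiv ℝ f p) p := (hf.differentiable (by norm_num) p).hasFDerivAt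
  have h2 : HasFDerivAt χ (fderiv ℝ χ p) p := (hχ.differentiable (by norm_num) p).hasFDerivAt
  have h3 : HasFDerivAt G (fderiv ℝ G p) p := (hG.differentiable (by norm_num) p).hasFDerivAt
  exact (h1.add ((h2.mul h3).const_mul s)).fderiv

lemma step_exists {E : Type*} [NormedAddCommGroup E] [NormedSpace ℝ E] [FiniteDimensional ℝ E]
    {K : Set E} (hK : IsCompact K) (G : ℕ → E → ℝ) {L c' : ℝ} (hL : 0 ≤ L) (hc' : 0 < c')
    (hG : ∀ k, ContDiff ℝ 1 (G k)) (hGL : ∀ k p, ‖fderiv ℝ (G k) p‖ ≤ L)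
    (hG0 : ∀ ε > 0, ∃ N, ∀ k ≥ N, ∀ p, |G k p| ≤ ε)
    (hGc : ∀ k, ∀ p ∈ K, c' ≤ ‖fderiv ℝ (G k) p‖)
    (hGC : ∀ ε > 0, ∃ N, ∀ k ≥ N, ∀ l ≥ N, ∀ p ∈ K, ‖fderiv ℝ (G k) p - fderiv ℝ (G l) p‖ ≤ ε)
    (f : E → ℝ) (hf : ContDiff ℝ 1 f) (hfM : ∀ p, ‖fderiv ℝ f p‖ ≤ 2 * L + 3)
    (hfK : ∃ s < 1, ∀ p ∈ K, ‖fderiv ℝ f p‖ ≤ s) (η : ℝ) (hη : 0 < η) :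
    ∃ f' : E → ℝ, ContDiff ℝ 1 f' ∧ (∀ p, ‖fderiv ℝ f' p‖ ≤ 2 * L + 3) ∧ (∀ p, |f' p - f p| ≤ η) ∧
      (∀ p ∈ K, c' / 2 ≤ ‖fderiv ℝ f' p - fderiv ℝ f p‖) ∧
      ∀ η' > 0, ∃ f'' : E → ℝ, ContDiff ℝ 1 f'' ∧ (∀ p, ‖fderiv ℝ f'' p‖ ≤ 2 * L + 3) ∧
        (∃ s < 1, ∀ p ∈ K, ‖fderiv ℝ f'' p‖ ≤ s) ∧ (∀ p, |f'' p - f' p| ≤ η') := by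
  obtain ⟨s, hs, hsK⟩ := hfK
  have cont : ∀ f : E → ℝ, ContDiff ℝ 1 f → Continuous (fun p => ‖fderiv ℝ f p‖) :=
    fun f hf => (hf.continuous_fderiv (by norm_num)).norm
  obtain ⟨χ, B, hB, hχ, hχ01, hχ1, hχB, hχ0⟩ := cutoff_exists hK
    (O := {p | ‖fderiv ℝ f p‖ < 1}) (isOpen_lt (cont f hf) continuous_const)
    (fun p hp => (hsK p hp).trans_lt hs)
  set σ := 1 - s with hσ
  have hσ0 : 0 < σ := by linarith
  obtain ⟨N1, hN1⟩ := hG0 (min η (min (c' / 2) (min 1 (σ / 4)) / B)) (by positivity)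
  obtain ⟨N2, hN2⟩ := hGC (σ / 4) (by positivity)
  set a := max N1 N2
  have hGa : ∀ p, |G a p| ≤ min η (min (c' / 2) (min 1 (σ / 4)) / B) := hN1 a (le_max_left _ _)
  have hsmall : ∀ p, ‖G a p • fderiv ℝ χ p‖ ≤ min (c' / 2) (min 1 (σ / 4)) := by
    intro p
    rw [norm_smul, Real.norm_eq_abs]
    calc |G a p| * ‖fderiv ℝ χ p‖ ≤ (min (c' / 2) (min 1 (σ / 4)) / B) * B := by
          gcongr
          · exact (hGa p).trans (min_le_right _ _)
          · exact hχB p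
      _ = _ := by field_simp
  have hχG : ∀ (χ G : E → ℝ) (p : E), 0 ≤ χ p ∧ χ p ≤ 1 → ‖fderiv ℝ G p‖ ≤ L →
      ‖χ p • fderiv ℝ G p‖ ≤ L := by
    intro χ G p h1 h2
    rw [norm_smul, Real.norm_eq_abs, abs_of_nonneg h1.1]
    calc χ p * ‖fderiv ℝ G p‖ ≤ 1 * L := by gcongr; exact h1.2
      _ = L := one_mul L
  have habs : ∀ (χ G : E → ℝ) (p : E), 0 ≤ χ p ∧ χ p ≤ 1 → |χ p * G p| ≤ |G p| := by
    intro χ G p h1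
    rw [abs_mul, abs_of_nonneg h1.1]
    exact mul_le_of_le_one_left (abs_nonneg _) h1.2
  set f' : E → ℝ := fun p => f p + 1 * (χ p * G a p) with hf'
  have hf'C : ContDiff ℝ 1 f' := hf.add (contDiff_const.mul (hχ.mul (hG a)))
  have hf'd : ∀ p, fderiv ℝ f' p = fderiv ℝ f p + (1:ℝ) • (χ p • fderiv ℝ (G a) p + G a p • fderiv ℝ χ p) :=
    fun p => fderiv_add_cut hf hχ (hG a) 1 p
  have hf'K : ∀ p ∈ K, fderiv ℝ f' p = fderiv ℝ f p + (fderiv ℝ (G a) p + G a p • fderiv ℝ χ p) := by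
    intro p hp
    rw [hf'd, hχ1 p hp, one_smul, one_smul]
  refine ⟨f', hf'C, ?_, ?_, ?_, ?_⟩
  · intro p
    rw [hf'd]
    by_cases hp : ‖fderiv ℝ f p‖ < 1
    · have h1 := hχG χ (G a) p (hχ01 p) (hGL a p)
      have h2 := (hsmall p).trans ((min_le_right _ _).trans (min_le_left _ _))
      rw [one_smul]
      have h3 := norm_add_le (fderiv ℝ f p) (χ p • fderiv ℝ (G a) p + G a p • fderiv ℝ χ p)
      have h4 := norm_add_le (χ p • fderiv ℝ (G a) p) (G a p • fderiv ℝ χ p)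
      linarith
    · obtain ⟨h1, h2⟩ := hχ0 p hp
      rw [h1, h2]; simpa using hfM p
  · intro p
    have : f' p - f p = χ p * G a p := by simp [hf']
    rw [this]
    exact (habs χ (G a) p (hχ01 p)).trans ((hGa p).trans (min_le_left _ _))
  · intro p hp
    rw [hf'K p hp, add_sub_cancel_left]
    have h1 := hGc a p hp
    have h2 := (hsmall p).trans (min_le_left _ _)
    have h3 := norm_sub_le (fderiv ℝ (G a) p + G a p • fderiv ℝ χ p) (G a p • fderiv ℝ χ p)
    rw [add_sub_cancel_right] at h3
    linarith
  · intro η' hη'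
    have hKO' : K ⊆ {p | ‖fderiv ℝ f' p‖ < L + 2} := by
      intro p hp
      show ‖fderiv ℝ f' p‖ < L + 2
      rw [hf'K p hp]
      have h1 := hGL a p
      have h2 := (hsmall p).trans ((min_le_right _ _).trans (min_le_left _ _))
      have h3 := norm_add_le (fderiv ℝ f p) (fderiv ℝ (G a) p + G a p • fderiv ℝ χ p)
      have h4 := norm_add_le (fderiv ℝ (G a) p) (G a p • fderiv ℝ χ p)
      have h5 := hsK p hp
      linarith
    obtain ⟨χ', B', hB', hχ', hχ01', hχ1', hχB', hχ0'⟩ := cutoff_exists hK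
      (O := {p | ‖fderiv ℝ f' p‖ < L + 2}) (isOpen_lt (cont f' hf'C) continuous_const) hKO'
    obtain ⟨N3, hN3⟩ := hG0 (min η' (min 1 (σ / 4) / B')) (by positivity)
    set b := max N3 N2
    have hGb : ∀ p, |G b p| ≤ min η' (min 1 (σ / 4) / B') := hN3 b (le_max_left _ _)
    have hsmall' : ∀ p, ‖G b p • fderiv ℝ χ' p‖ ≤ min 1 (σ / 4) := by
      intro p
      rw [norm_smul, Real.norm_eq_abs]
      calc |G b p| * ‖fderiv ℝ χ' p‖ ≤ (min 1 (σ / 4) / B') * B' := by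
            gcongr
            · exact (hGb p).trans (min_le_right _ _)
            · exact hχB' p
        _ = _ := by field_simp
    set f'' : E → ℝ := fun p => f' p + (-1) * (χ' p * G b p) with hf''
    have hf''d : ∀ p, fderiv ℝ f'' p = fderiv ℝ f' p + (-1:ℝ) • (χ' p • fderiv ℝ (G b) p + G b p • fderiv ℝ χ' p) :=
      fun p => fderiv_add_cut hf'C hχ' (hG b) (-1) p
    refine ⟨f'', hf'C.add (contDiff_const.mul (hχ'.mul (hG b))), ?_, ⟨s + 3 * (σ / 4), by linarith, ?_⟩, ?_⟩
    · intro p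
      rw [hf''d]
      by_cases hp : ‖fderiv ℝ f' p‖ < L + 2
      · have h1 := hχG χ' (G b) p (hχ01' p) (hGL b p)
        have h2 := (hsmall' p).trans (min_le_left _ _)
        rw [neg_one_smul]
        have h3 := norm_add_le (fderiv ℝ f' p) (-(χ' p • fderiv ℝ (G b) p + G b p • fderiv ℝ χ' p))
        rw [norm_neg] at h3
        have h4 := norm_add_le (χ' p • fderiv ℝ (G b) p) (G b p • fderiv ℝ χ' p)
        linarith
      · obtain ⟨h1, h2⟩ := hχ0' p hp
        rw [h1, h2]
        have : ‖fderiv ℝ f' p‖ ≤ 2 * L + 3 := by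
          rw [hf'd]
          by_cases hp : ‖fderiv ℝ f p‖ < 1
          · have h1 := hχG χ (G a) p (hχ01 p) (hGL a p)
            have h2 := (hsmall p).trans ((min_le_right _ _).trans (min_le_left _ _))
            rw [one_smul]
            have h3 := norm_add_le (fderiv ℝ f p) (χ p • fderiv ℝ (G a) p + G a p • fderiv ℝ χ p)
            have h4 := norm_add_le (χ p • fderiv ℝ (G a) p) (G a p • fderiv ℝ χ p)
            linarith
          · obtain ⟨h1, h2⟩ := hχ0 p hp
            rw [h1, h2]; simpa using hfM p
        simpa using this
    · intro p hp
      rw [hf''d, hf'K p hp, hχ1' p hp, neg_one_smul, one_smul]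
      have e : fderiv ℝ f p + (fderiv ℝ (G a) p + G a p • fderiv ℝ χ p) +
          -(fderiv ℝ (G b) p + G b p • fderiv ℝ χ' p) =
          fderiv ℝ f p + ((fderiv ℝ (G a) p - fderiv ℝ (G b) p) + (G a p • fderiv ℝ χ p - G b p • fderiv ℝ χ' p)) := by
        abel
      rw [e]
      have h1 := hN2 a (le_max_right _ _) b (le_max_right _ _) p hp
      have h2 := (hsmall p).trans ((min_le_right _ _).trans (min_le_right _ _))
      have h3 := (hsmall' p).trans (min_le_right _ _)
      have h4 := norm_add_le (fderiv ℝ f p) ((fderiv ℝ (G a) p - fderiv ℝ (G b) p) + (G a p • fderiv ℝ χ p - G b p • fderiv ℝ χ' p))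
      have h5 := norm_add_le (fderiv ℝ (G a) p - fderiv ℝ (G b) p) (G a p • fderiv ℝ χ p - G b p • fderiv ℝ χ' p)
      have h6 := norm_sub_le (G a p • fderiv ℝ χ p) (G b p • fderiv ℝ χ' p)
      have h7 := hsK p hp
      linarith
    · intro p
      have : f'' p - f' p = -(χ' p * G b p) := by simp [hf'']
      rw [this, abs_neg]
      exact (habs χ' (G b) p (hχ01' p)).trans ((hGb p).trans (min_le_left _ _))


lemma fluct_exists {X E : Type*} [MetricSpace X] [NormedAddCommGroup E] [NormedSpace ℝ E]
    [FiniteDimensional ℝ E] {φ : X → E} {K : ℝ≥0} (hφ : LipschitzWith K φ) {S : Set X}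
    (hS : IsCompact S) {c : ℝ}
    (hc : ∀ x ∈ S, ∀ D : E →L[ℝ] ℝ, ∀ r > 0, ∃ y, 0 < dist y x ∧ dist y x < r ∧
      c * ‖D‖ * dist y x ≤ |D (φ y - φ x)|)
    (R : ℝ) (f : E → ℝ) (hf : ContDiff ℝ 1 f) (r : ℝ) (hr : 0 < r) :
    ∃ β > 0, ∀ x ∈ S, ∀ D : E →L[ℝ] ℝ, ‖D‖ ≤ R → ∃ y, 0 < dist y x ∧ dist y x < r ∧
      (c * ‖fderiv ℝ f (φ x) - D‖ - r) * dist y x ≤ |f (φ y) - f (φ x) - D (φ y - φ x)| ∧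
      2 * β ≤ r * dist y x := by
  have hcomp : IsCompact (S ×ˢ closedBall (0 : E →L[ℝ] ℝ) R) :=
    hS.prod (isCompact_closedBall _ _)
  have key : ∃ β > 0, ∀ z ∈ S ×ˢ closedBall (0 : E →L[ℝ] ℝ) R, ∃ y, 0 < dist y z.1 ∧ dist y z.1 < r ∧
      (c * ‖fderiv ℝ f (φ z.1) - z.2‖ - r) * dist y z.1 ≤ |f (φ y) - f (φ z.1) - z.2 (φ y - φ z.1)| ∧
      2 * β ≤ r * dist y z.1 := by
    refine hcomp.induction_on (p := fun s => ∃ β > 0, ∀ z ∈ s, ∃ y, 0 < dist y z.1 ∧ dist y z.1 < r ∧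
      (c * ‖fderiv ℝ f (φ z.1) - z.2‖ - r) * dist y z.1 ≤ |f (φ y) - f (φ z.1) - z.2 (φ y - φ z.1)| ∧
      2 * β ≤ r * dist y z.1) ⟨1, one_pos, by simp⟩ ?_ ?_ ?_
    · rintro s t hst ⟨β, hβ, h⟩
      exact ⟨β, hβ, fun z hz => h z (hst hz)⟩
    · rintro s t ⟨β, hβ, h⟩ ⟨β', hβ', h'⟩
      refine ⟨min β β', lt_min hβ hβ', ?_⟩
      rintro z (hz | hz)
      · obtain ⟨y, h1, h2, h3, h4⟩ := h z hz
        exact ⟨y, h1, h2, h3, by linarith [min_le_left β β']⟩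
      · obtain ⟨y, h1, h2, h3, h4⟩ := h' z hz
        exact ⟨y, h1, h2, h3, by linarith [min_le_right β β']⟩
    · rintro ⟨x0, D0⟩ ⟨hx0, -⟩
      simp only at hx0
      have hd : HasFDerivAt f (fderiv ℝ f (φ x0)) (φ x0) :=
        (hf.differentiable (by norm_num) _).hasFDerivAt
      have hε : 0 < r / 2 / (K + 1) := by positivity
      have h1 := hd.isLittleO.def hε
      have h2 := hφ.continuous.continuousAt (x := x0) |>.eventually h1
      obtain ⟨ρ, hρ, h3⟩ := Metric.eventually_nhds_iff.1 h2
      obtain ⟨y0, hy0, hy1, hy2⟩ := hc x0 hx0 (fderiv ℝ f (φ x0) - D0) (min ρ r) (lt_min hρ hr)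
      have hyρ := hy1.trans_le (min_le_left _ _)
      have hyr := hy1.trans_le (min_le_right _ _)
      have h4 := h3 hyρ
      have h5 : ‖φ y0 - φ x0‖ ≤ K * dist y0 x0 := by
        rw [← dist_eq_norm]; exact hφ.dist_le_mul _ _
      have h6 : |f (φ y0) - f (φ x0) - fderiv ℝ f (φ x0) (φ y0 - φ x0)| ≤ r / 2 * dist y0 x0 := by
        rw [Real.norm_eq_abs] at h4
        refine h4.trans ?_
        calc r / 2 / (K + 1) * ‖φ y0 - φ x0‖ ≤ r / 2 / (K + 1) * ((K + 1) * dist y0 x0) := by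
              gcongr
              refine h5.trans ?_
              gcongr
              linarith
          _ = r / 2 * dist y0 x0 := by field_simp
      have h7 : (c * ‖fderiv ℝ f (φ x0) - D0‖ - r) * dist y0 x0 <
          |f (φ y0) - f (φ x0) - D0 (φ y0 - φ x0)| := by
        have e : (fderiv ℝ f (φ x0) - D0) (φ y0 - φ x0) =
          (f (φ y0) - f (φ x0) - D0 (φ y0 - φ x0)) -
          (f (φ y0) - f (φ x0) - fderiv ℝ f (φ x0) (φ y0 - φ x0)) := by
          rw [ContinuousLinearMap.sub_apply]; ring
        rw [e] at hy2
        have := abs_sub (f (φ y0) - f (φ x0) - D0 (φ y0 - φ x0))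
          (f (φ y0) - f (φ x0) - fderiv ℝ f (φ x0) (φ y0 - φ x0))
        have h8 : 0 < r / 2 * dist y0 x0 := by positivity
        nlinarith
      have cf : Continuous f := hf.continuous
      have cφ : Continuous φ := hφ.continuous
      have cdf : Continuous (fderiv ℝ f) := hf.continuous_fderiv (by norm_num)
      have c1 : Continuous fun z : X × (E →L[ℝ] ℝ) =>
          (c * ‖fderiv ℝ f (φ z.1) - z.2‖ - r) * dist y0 z.1 := by fun_prop
      have c2 : Continuous fun z : X × (E →L[ℝ] ℝ) =>
          |f (φ y0) - f (φ z.1) - z.2 (φ y0 - φ z.1)| := by fun_prop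
      have c3 : Continuous fun z : X × (E →L[ℝ] ℝ) => dist y0 z.1 := by fun_prop
      have o1 := (isOpen_lt c1 c2).mem_nhds (x := (x0, D0)) h7
      have o2 := (isOpen_lt c3 continuous_const).mem_nhds (x := (x0, D0)) hyr
      have o3 := (isOpen_lt (continuous_const (y := dist y0 x0 / 2)) c3).mem_nhds (x := (x0, D0)) (half_lt_self hy0)
      refine ⟨_, mem_nhdsWithin_of_mem_nhds (inter_mem o1 (inter_mem o2 o3)),
        r * (dist y0 x0 / 2) / 2, by positivity, ?_⟩
      rintro z ⟨g1, g2, g3⟩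
      simp only [mem_setOf_eq] at g1 g2 g3
      refine ⟨y0, by linarith, g2, g1.le, ?_⟩
      nlinarith
  obtain ⟨β, hβ, h⟩ := key
  exact ⟨β, hβ, fun x hx D hD => h (x, D) ⟨hx, by simpa using hD⟩⟩

/-- The nowhere differentiable function. -/
lemma nondiff_exists {X E : Type*} [MetricSpace X] [NormedAddCommGroup E] [NormedSpace ℝ E]
    [FiniteDimensional ℝ E] {φ : X → E} {K : ℝ≥0} (hφ : LipschitzWith K φ) {S : Set X}
    (hS : IsCompact S) {c : ℝ} (hc0 : 0 < c)
    (hc : ∀ x ∈ S, ∀ D : E →L[ℝ] ℝ, ∀ r > 0, ∃ y, 0 < dist y x ∧ dist y x < r ∧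
      c * ‖D‖ * dist y x ≤ |D (φ y - φ x)|)
    (G : ℕ → E → ℝ) {L c' : ℝ} (hL : 0 ≤ L) (hc' : 0 < c')
    (hG : ∀ k, ContDiff ℝ 1 (G k)) (hGL : ∀ k p, ‖fderiv ℝ (G k) p‖ ≤ L)
    (hG0 : ∀ ε > 0, ∃ N, ∀ k ≥ N, ∀ p, |G k p| ≤ ε)
    (hGc : ∀ k, ∀ p ∈ φ '' S, c' ≤ ‖fderiv ℝ (G k) p‖)
    (hGC : ∀ ε > 0, ∃ N, ∀ k ≥ N, ∀ l ≥ N, ∀ p ∈ φ '' S, ‖fderiv ℝ (G k) p - fderiv ℝ (G l) p‖ ≤ ε) :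
    ∃ F : X → ℝ, (∃ K' : ℝ≥0, LipschitzWith K' F) ∧ ∀ x ∈ S, ∀ D : E →L[ℝ] ℝ,
      ¬ Tendsto (fun y => |F y - F x - D (φ y - φ x)| / dist y x) (𝓝[≠] x) (𝓝 0) := by
  have hK : IsCompact (φ '' S) := hS.image hφ.continuous
  set M : ℝ := 2 * L + 3 with hM
  have hM0 : 0 ≤ M := by positivity
  set R : ℝ := (M * K + 1) / c with hR
  -- the fluctuation property
  let Φ : (E → ℝ) → ℝ → ℝ → Prop := fun f β r => ∀ x ∈ S, ∀ D : E →L[ℝ] ℝ, ‖D‖ ≤ R →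
    ∃ y, 0 < dist y x ∧ dist y x < r ∧
      (c * ‖fderiv ℝ f (φ x) - D‖ - r) * dist y x ≤ |f (φ y) - f (φ x) - D (φ y - φ x)| ∧
      2 * β ≤ r * dist y x
  have hΦ : ∀ f, ContDiff ℝ 1 f → ∀ r > 0, ∃ β > 0, Φ f β r := fun f hf r hr =>
    fluct_exists hφ hS hc R f hf r hr
  have hΦmono : ∀ f β β' r, β' ≤ β → Φ f β r → Φ f β' r := by
    intro f β β' r h hf x hx D hD
    obtain ⟨y, h1, h2, h3, h4⟩ := hf x hx D hD
    exact ⟨y, h1, h2, h3, by linarith⟩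
  let Ev : (E → ℝ) → Prop := fun f => ContDiff ℝ 1 f ∧ (∀ p, ‖fderiv ℝ f p‖ ≤ M) ∧
    (∃ s < 1, ∀ p ∈ φ '' S, ‖fderiv ℝ f p‖ ≤ s)
  have hstep : ∀ (k : ℕ) (z : {z : (E → ℝ) × ℝ // Ev z.1 ∧ 0 < z.2}),
      ∃ (w : {z : (E → ℝ) × ℝ // Ev z.1 ∧ 0 < z.2}) (f' : E → ℝ) (β' : ℝ),
        (∀ p, |f' p - z.1.1 p| ≤ z.1.2 / 2) ∧ β' ≤ z.1.2 / 2 ∧ Φ f' β' (1 / (k + 1)) ∧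
        (∀ p ∈ φ '' S, c' / 2 ≤ ‖fderiv ℝ f' p - fderiv ℝ z.1.1 p‖) ∧
        (∀ p, |w.1.1 p - f' p| ≤ β' / 2) ∧ w.1.2 ≤ β' / 2 ∧ Φ w.1.1 w.1.2 (1 / (k + 2)) := by
    rintro k ⟨⟨f, β⟩, ⟨hf, hfM, hfK⟩, hβ⟩
    obtain ⟨f', hf', hfM', hff', hfd, hnext⟩ := step_exists hK G hL hc' hG hGL hG0 hGc hGC f hf hfM hfK
      (β / 2) (half_pos hβ)
    obtain ⟨β1, hβ1, hΦ1⟩ := hΦ f' hf' (1 / (k + 1)) (by positivity)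
    have hβ'0 : 0 < min β1 (β / 2) := lt_min hβ1 (half_pos hβ)
    obtain ⟨f'', hf'', hfM'', hfK'', hff''⟩ := hnext (min β1 (β / 2) / 2) (half_pos hβ'0)
    obtain ⟨β2, hβ2, hΦ2⟩ := hΦ f'' hf'' (1 / (k + 2)) (by positivity)
    refine ⟨⟨⟨f'', min β2 (min β1 (β / 2) / 2)⟩, ⟨hf'', hfM'', hfK''⟩, lt_min hβ2 (half_pos hβ'0)⟩, f',
      min β1 (β / 2), hff', min_le_right _ _, hΦmono _ _ _ _ (min_le_left _ _) hΦ1, hfd, hff'',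
      min_le_right _ _, hΦmono _ _ _ _ (min_le_left _ _) hΦ2⟩
  choose nxt f' β' h1 h2 h3 h4 h5 h6 h7 using hstep
  have hE0 : Ev (fun _ => 0) := by
    refine ⟨contDiff_const, fun p => ?_, 0, one_pos, fun p _ => ?_⟩
    · simpa using hM0
    · simp
  let seq : ℕ → {z : (E → ℝ) × ℝ // Ev z.1 ∧ 0 < z.2} := fun k =>
    Nat.rec ⟨⟨fun _ => 0, 1⟩, hE0, one_pos⟩ (fun k z => nxt k z) k
  have hseq : ∀ k, seq (k + 1) = nxt k (seq k) := fun k => rfl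
  have hβhalf : ∀ k, (seq (k+1)).1.2 ≤ (seq k).1.2 / 2 := by
    intro k
    rw [hseq]
    have a1 := h2 k (seq k)
    have a2 := h6 k (seq k)
    have := (seq k).2.2
    have := (nxt k (seq k)).2.2
    linarith
  have hdiff : ∀ k p, |(seq (k+1)).1.1 p - (seq k).1.1 p| ≤ (seq k).1.2 - (seq (k+1)).1.2 := by
    intro k p
    rw [hseq]
    have a1 := h1 k (seq k) p
    have a2 := h5 k (seq k) p
    have a3 := h2 k (seq k)
    have a4 := h6 k (seq k)
    have a5 := abs_sub_le ((nxt k (seq k)).1.1 p) (f' k (seq k) p) ((seq k).1.1 p)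
    have := (nxt k (seq k)).2.2
    linarith
  have hdiff2 : ∀ k m p, |(seq (k+m)).1.1 p - (seq k).1.1 p| ≤ (seq k).1.2 - (seq (k+m)).1.2 := by
    intro k m p
    induction m with
    | zero => simp
    | succ m ih =>
      have a1 := hdiff (k+m) p
      have a2 := abs_sub_le ((seq (k+m+1)).1.1 p) ((seq (k+m)).1.1 p) ((seq k).1.1 p)
      rw [← add_assoc]
      linarith
  have hβpow : ∀ k, (seq k).1.2 ≤ (1/2)^k := by
    intro k
    induction k with
    | zero => simp [seq]
    | succ k ih =>
      have := hβhalf k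
      rw [pow_succ]; linarith
  have hlim : ∀ p, ∃ l, Tendsto (fun k => (seq k).1.1 p) atTop (𝓝 l) := by
    intro p
    apply cauchySeq_tendsto_of_complete
    apply cauchySeq_of_le_geometric (1/2) 1 (by norm_num)
    intro k
    rw [dist_comm, Real.dist_eq, one_mul]
    have := hdiff k p
    have := (seq (k+1)).2.2
    linarith [hβpow k]
  choose F hF using hlim
  have hFk : ∀ k p, |F p - (seq k).1.1 p| ≤ (seq k).1.2 := by
    intro k p
    have t1 : Tendsto (fun m => |(seq (k+m)).1.1 p - (seq k).1.1 p|) atTop (𝓝 |F p - (seq k).1.1 p|) := by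
      have := (tendsto_add_atTop_iff_nat k).2 (hF p)
      simp_rw [add_comm _ k] at this
      exact (this.sub_const _).abs
    refine le_of_tendsto t1 (Eventually.of_forall fun m => ?_)
    have := hdiff2 k m p
    have := (seq (k+m)).2.2
    linarith
  have hFk' : ∀ k p, |F p - f' k (seq k) p| ≤ β' k (seq k) := by
    intro k p
    have a1 := hFk (k+1) p
    rw [hseq] at a1
    have a2 := h5 k (seq k) p
    have a3 := h6 k (seq k)
    have a4 := abs_sub_le (F p) ((nxt k (seq k)).1.1 p) (f' k (seq k) p)
    linarith
  have hFM : LipschitzWith (M.toNNReal) F := by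
    refine LipschitzWith.of_dist_le_mul fun p q => ?_
    have t1 := (hF p).dist (hF q)
    refine le_of_tendsto t1 (Eventually.of_forall fun k => ?_)
    have : LipschitzWith (M.toNNReal) (seq k).1.1 := by
      apply lipschitzWith_of_nnnorm_fderiv_le ((seq k).2.1.1.differentiable (by norm_num))
      intro p
      rw [← NNReal.coe_le_coe, Real.coe_toNNReal _ hM0]
      exact (seq k).2.1.2.1 p
    exact this.dist_le_mul _ _
  refine ⟨F ∘ φ, ⟨_, hFM.comp hφ⟩, ?_⟩
  intro x hx D hT
  have hT' : ∀ ε > 0, ∃ r > 0, ∀ y, 0 < dist y x → dist y x < r →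
      |F (φ y) - F (φ x) - D (φ y - φ x)| ≤ ε * dist y x := by
    intro ε hε
    have := hT.eventually (gt_mem_nhds hε)
    rw [eventually_nhdsWithin_iff, Metric.eventually_nhds_iff] at this
    obtain ⟨r, hr, h⟩ := this
    refine ⟨r, hr, fun y hy0 hyr => ?_⟩
    have := h hyr (by
      intro h; rw [mem_singleton_iff] at h; rw [h] at hy0; simp at hy0)
    simp only [Function.comp] at this
    rw [div_lt_iff₀ hy0] at this
    exact this.le
  have hDR : ‖D‖ ≤ R := by
    obtain ⟨r, hr, h⟩ := hT' 1 one_pos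
    obtain ⟨y, hy0, hyr, hy⟩ := hc x hx D r hr
    have a1 := h y hy0 hyr
    have a2 : |F (φ y) - F (φ x)| ≤ M * K * dist y x := by
      have := (hFM.comp hφ).dist_le_mul y x
      rw [NNReal.coe_mul, Real.coe_toNNReal _ hM0, Real.dist_eq] at this
      exact this
    have a3 := abs_sub (F (φ y) - F (φ x)) (F (φ y) - F (φ x) - D (φ y - φ x))
    rw [sub_sub_cancel] at a3
    have a4 : c * ‖D‖ * dist y x ≤ (M * K + 1) * dist y x := by linarith
    have a5 := le_of_mul_le_mul_right a4 hy0
    rw [hR, le_div_iff₀ hc0]; linarith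
  have hmain : ∀ (f : E → ℝ) (β r ε ρ : ℝ), (∀ p, |F p - f p| ≤ β) → Φ f β r → r ≤ ρ →
      (∀ y, 0 < dist y x → dist y x < ρ →
        |F (φ y) - F (φ x) - D (φ y - φ x)| ≤ ε * dist y x) →
      c * ‖fderiv ℝ f (φ x) - D‖ ≤ 2 * r + ε := by
    intro f β r ε ρ hFf hΦf hrρ hε
    obtain ⟨y, hy0, hyr, hy, hyβ⟩ := hΦf x hx D hDR
    have a1 := hε y hy0 (hyr.trans_le hrρ)
    have a2 := hFf (φ y)
    have a3 := hFf (φ x)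
    have a4 : |f (φ y) - f (φ x) - D (φ y - φ x)| ≤ |F (φ y) - F (φ x) - D (φ y - φ x)| + 2 * β := by
      rw [abs_le] at a2 a3
      rw [abs_le]
      have := abs_le.1 (le_refl |F (φ y) - F (φ x) - D (φ y - φ x)|)
      constructor <;> linarith
    have a5 : (c * ‖fderiv ℝ f (φ x) - D‖ - r) * dist y x ≤ (ε + r) * dist y x := by linarith
    have := le_of_mul_le_mul_right a5 hy0
    linarith
  set ε := c * c' / 16 with hε
  have hε0 : 0 < ε := by positivity
  obtain ⟨ρ, hρ, hρε⟩ := hT' ε hε0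
  obtain ⟨k, hk⟩ := exists_nat_one_div_lt (lt_min hρ hε0)
  have hkρ : (1:ℝ) / (k + 1) ≤ ρ := hk.le.trans (min_le_left _ _)
  have hkε : (1:ℝ) / (k + 1) ≤ ε := hk.le.trans (min_le_right _ _)
  have hmono : (1:ℝ) / ((k:ℝ) + 1 + 1) ≤ 1 / (k + 1) := by
    apply one_div_le_one_div_of_le <;> [positivity; linarith]
  have hmono2 : (1:ℝ) / ((k:ℝ) + 2) ≤ 1 / (k + 1) := by
    apply one_div_le_one_div_of_le <;> [positivity; linarith]
  have b1 := hmain (seq (k+1)).1.1 _ (1 / (k+2)) ε ρ (hFk (k+1)) (h7 k (seq k)) (hmono2.trans hkρ) hρε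
  have b2 := hmain (f' (k+1) (seq (k+1))) _ (1 / (((k+1 : ℕ) : ℝ)+1)) ε ρ (hFk' (k+1)) (h3 (k+1) (seq (k+1)))
    (by push_cast; exact hmono.trans hkρ) hρε
  push_cast at b2
  have b3 := h4 (k+1) (seq (k+1)) (φ x) (mem_image_of_mem _ hx)
  have b4 := norm_sub_le (fderiv ℝ (f' (k+1) (seq (k+1))) (φ x) - D) (fderiv ℝ (seq (k+1)).1.1 (φ x) - D)
  rw [sub_sub_sub_cancel_right] at b4
  have b5 : c * (c' / 2) ≤ c * (‖fderiv ℝ (f' (k+1) (seq (k+1))) (φ x) - D‖ + ‖fderiv ℝ (seq (k+1)).1.1 (φ x) - D‖) :=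
    mul_le_mul_of_nonneg_left (b3.trans b4) hc0.le
  have b6 : c * (c' / 2) = 8 * ε := by rw [hε]; ring
  linarith


lemma min_seq {V : Type*} [AddCommGroup V] (K : ℕ → Set V) (hanti : Antitone K)
    (hne : ∀ k, (K k).Nonempty) (Q : V → ℝ) (B : ℝ) (hQ0 : ∀ g ∈ K 0, 0 ≤ Q g)
    (hQB : ∀ g ∈ K 0, Q g ≤ B)
    (hpar : ∀ k, ∀ a ∈ K k, ∀ b ∈ K k, ∃ m ∈ K k, Q (a - b) + 4 * Q m ≤ 2 * Q a + 2 * Q b)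
    (θ : ℕ → ℝ) (hθ : ∀ k, 0 < θ k) (hθa : Antitone θ) :
    ∃ g : ℕ → V, ∀ k, g k ∈ K k ∧ Q (g k - g (k+1)) ≤ 8 * θ k := by
  have hbdd : ∀ k, BddBelow (Q '' K k) := fun k => ⟨0, by
    rintro _ ⟨g, hg, rfl⟩; exact hQ0 g (hanti (Nat.zero_le k) hg)⟩
  set d : ℕ → ℝ := fun k => sInf (Q '' K k) with hd
  have hdmono : Monotone d := fun k l hkl =>
    csInf_le_csInf (hbdd k) ((hne l).image Q) (image_mono (hanti hkl))
  have hdB : ∀ k, d k ≤ B := by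
    intro k
    obtain ⟨g, hg⟩ := hne k
    exact (csInf_le (hbdd k) (mem_image_of_mem Q hg)).trans (hQB g (hanti (Nat.zero_le k) hg))
  have hbA : BddAbove (range d) := ⟨B, by rintro _ ⟨k, rfl⟩; exact hdB k⟩
  set s := ⨆ k, d k with hs
  have hds : ∀ k, d k ≤ s := fun k => le_ciSup hbA k
  have hchoose : ∀ k, ∃ m ≥ k, s - θ k < d m := by
    intro k
    obtain ⟨m, hm⟩ := exists_lt_of_lt_ciSup (show s - θ k < ⨆ k, d k by rw [← hs]; linarith [hθ k])
    exact ⟨max m k, le_max_right _ _, hm.trans_le (hdmono (le_max_left _ _))⟩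
  choose m hmk hm using hchoose
  have hg : ∀ k, ∃ g ∈ K (m k), Q g < d (m k) + θ k := by
    intro k
    obtain ⟨_, ⟨g, hg, rfl⟩, h⟩ := exists_lt_of_csInf_lt ((hne (m k)).image Q)
      (show sInf (Q '' K (m k)) < d (m k) + θ k by linarith [hθ k])
    exact ⟨g, hg, h⟩
  choose g hgK hgQ using hg
  refine ⟨g, fun k => ⟨hanti (hmk k) (hgK k), ?_⟩⟩
  have hth := hθa (Nat.le_succ k)
  set j := min (m k) (m (k+1)) with hj
  have hdj : s - θ k ≤ d j := by
    rcases min_choice (m k) (m (k+1)) with h | h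
    · rw [hj, h]; exact (hm k).le
    · rw [hj, h]; have := hm (k+1); simp only [Nat.succ_eq_add_one] at hth; linarith
  obtain ⟨w, hw, hpw⟩ := hpar j (g k) (hanti (min_le_left _ _) (hgK k)) (g (k+1))
    (hanti (min_le_right _ _) (hgK (k+1)))
  have h1 : d j ≤ Q w := csInf_le (hbdd j) (mem_image_of_mem Q hw)
  have h2 := hgQ k
  have h3 := hgQ (k+1)
  have h4 := hds (m k)
  have h5 := hds (m (k+1))
  simp only [Nat.succ_eq_add_one] at hth
  linarith

lemma dual_parallelogram {E : Type*} [NormedAddCommGroup E] [InnerProductSpace ℝ E]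
    [FiniteDimensional ℝ E] (a b : E →L[ℝ] ℝ) :
    ‖a - b‖ ^ 2 + 4 * ‖(1/2 : ℝ) • (a + b)‖ ^ 2 = 2 * ‖a‖ ^ 2 + 2 * ‖b‖ ^ 2 := by
  have h := parallelogram_law_with_norm ℝ ((InnerProductSpace.toDual ℝ E).symm a)
    ((InnerProductSpace.toDual ℝ E).symm b)
  rw [← map_add, ← map_sub] at h
  simp only [LinearIsometryEquiv.norm_map] at h
  rw [norm_smul]
  norm_num
  linarith

lemma select_seq {E : Type*} [NormedAddCommGroup E] [InnerProductSpace ℝ E]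
    [FiniteDimensional ℝ E] [MeasurableSpace E] [BorelSpace E] (ν : Measure E) [IsFiniteMeasure ν]
    (e : E) {c L : ℝ} (hc : 0 < c) (hL : 0 ≤ L)
    (h : ∀ ε > 0, ∃ g : E → ℝ, ContDiff ℝ 1 g ∧ (∀ p, |g p| ≤ ε) ∧ (∀ p, ‖fderiv ℝ g p‖ ≤ L) ∧
      c ≤ ∫ p, fderiv ℝ g p e ∂ν) :
    ∃ G : ℕ → E → ℝ, ∃ W : Set E, MeasurableSet W ∧ 0 < ν W ∧ ∃ c' > 0,
      (∀ k, ContDiff ℝ 1 (G k)) ∧ (∀ k p, ‖fderiv ℝ (G k) p‖ ≤ L) ∧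
      (∀ ε > 0, ∃ N, ∀ k ≥ N, ∀ p, |G k p| ≤ ε) ∧
      (∀ k, ∀ p ∈ W, c' ≤ ‖fderiv ℝ (G k) p‖) ∧
      (∀ ε > 0, ∃ N, ∀ k ≥ N, ∀ l ≥ N, ∀ p ∈ W, ‖fderiv ℝ (G k) p - fderiv ℝ (G l) p‖ ≤ ε) := by
  let K : ℕ → Set (E → ℝ) := fun k => {g | ContDiff ℝ 1 g ∧ (∀ p, |g p| ≤ 1 / ((k:ℝ) + 1)) ∧
    (∀ p, ‖fderiv ℝ g p‖ ≤ L) ∧ c ≤ ∫ p, fderiv ℝ g p e ∂ν}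
  have cont : ∀ g : E → ℝ, ContDiff ℝ 1 g → Continuous (fderiv ℝ g) :=
    fun g hg => hg.continuous_fderiv (by norm_num)
  have dif : ∀ g : E → ℝ, ContDiff ℝ 1 g → Differentiable ℝ g :=
    fun g hg => hg.differentiable (by norm_num)
  have hint : ∀ (u : E → E →L[ℝ] ℝ) (M : ℝ), Continuous u → (∀ p, ‖u p‖ ≤ M) →
      Integrable (fun p => ‖u p‖ ^ 2) ν := by
    intro u M hu hM
    refine Integrable.of_bound (C := M ^ 2) (by fun_prop) (Eventually.of_forall fun p => ?_)
    rw [Real.norm_eq_abs, abs_of_nonneg (by positivity)]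
    gcongr; exact hM p
  have hinte : ∀ g : E → ℝ, ContDiff ℝ 1 g → (∀ p, ‖fderiv ℝ g p‖ ≤ L) →
      Integrable (fun p => fderiv ℝ g p e) ν := by
    intro g hg hgL
    have := cont g hg
    refine Integrable.of_bound (C := L * ‖e‖) (by fun_prop) (Eventually.of_forall fun p => ?_)
    exact ((fderiv ℝ g p).le_opNorm e).trans (by gcongr; exact hgL p)
  let Q : (E → ℝ) → ℝ := fun g => ∫ p, ‖fderiv ℝ g p‖ ^ 2 ∂ν
  have hanti : Antitone K := by
    rintro k l hkl g ⟨h1, h2, h3, h4⟩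
    refine ⟨h1, fun p => (h2 p).trans ?_, h3, h4⟩
    apply one_div_le_one_div_of_le
    · positivity
    · have : (k:ℝ) ≤ l := by exact_mod_cast hkl
      linarith
  have hne : ∀ k, (K k).Nonempty := fun k => h (1 / ((k:ℝ)+1)) (by positivity)
  have hpar : ∀ k, ∀ a ∈ K k, ∀ b ∈ K k, ∃ m ∈ K k, Q (a - b) + 4 * Q m ≤ 2 * Q a + 2 * Q b := by
    rintro k a ⟨a1, a2, a3, a4⟩ b ⟨b1, b2, b3, b4⟩
    have hm : ∀ p, fderiv ℝ ((1/2:ℝ) • (a + b)) p = (1/2:ℝ) • (fderiv ℝ a p + fderiv ℝ b p) := by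
      intro p
      rw [fderiv_const_smul ((dif a a1 p).add (dif b b1 p)), fderiv_add (dif a a1 p) (dif b b1 p)]
    have hs : ∀ p, fderiv ℝ (a - b) p = fderiv ℝ a p - fderiv ℝ b p := by
      intro p
      rw [fderiv_sub (dif a a1 p) (dif b b1 p)]
    have hmL : ∀ p, ‖(1/2:ℝ) • (fderiv ℝ a p + fderiv ℝ b p)‖ ≤ L := by
      intro p
      rw [norm_smul]
      have := norm_add_le (fderiv ℝ a p) (fderiv ℝ b p)
      have := a3 p
      have := b3 p
      norm_num; linarith
    refine ⟨(1/2:ℝ) • (a + b), ⟨contDiff_const.smul (a1.add b1), fun p => ?_, fun p => ?_, ?_⟩, ?_⟩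
    · simp only [Pi.smul_apply, Pi.add_apply, smul_eq_mul]
      have h1 := abs_le.1 (a2 p)
      have h2 := abs_le.1 (b2 p)
      rw [abs_le]
      constructor <;> linarith
    · rw [hm]; exact hmL p
    · simp_rw [hm]
      simp only [ContinuousLinearMap.smul_apply, ContinuousLinearMap.add_apply, smul_eq_mul]
      rw [integral_const_mul, integral_add (hinte a a1 a3) (hinte b b1 b3)]
      linarith
    · simp only [Q]
      simp_rw [hm, hs]
      have ca := cont a a1
      have cb := cont b b1
      have i1 := hint (fun p => fderiv ℝ a p - fderiv ℝ b p) (L + L) (by fun_prop)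
        (fun p => (norm_sub_le _ _).trans (add_le_add (a3 p) (b3 p)))
      have i2 := hint (fun p => (1/2:ℝ) • (fderiv ℝ a p + fderiv ℝ b p)) L (by fun_prop) hmL
      have i3 := hint _ L ca a3
      have i4 := hint _ L cb b3
      rw [← integral_const_mul, ← integral_const_mul, ← integral_const_mul,
        ← integral_add i1 (i2.const_mul 4), ← integral_add (i3.const_mul 2) (i4.const_mul 2)]
      refine le_of_eq (integral_congr_ae (Eventually.of_forall fun p => ?_))
      exact dual_parallelogram _ _
  obtain ⟨g, hg⟩ := min_seq K hanti hne Q (∫ _p, L ^ 2 ∂ν)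
    (fun g _ => integral_nonneg fun p => by positivity)
    (by
      rintro g ⟨h1, h2, h3, h4⟩
      refine integral_mono (hint _ L (cont g h1) h3) (integrable_const _) fun p => ?_
      have := h3 p
      show ‖fderiv ℝ g p‖ ^ 2 ≤ L ^ 2
      gcongr)
    hpar (fun k => (1/8:ℝ)^k / 8) (fun k => by positivity) (by
      intro k l hkl
      have : (1/8:ℝ)^l ≤ (1/8:ℝ)^k := pow_le_pow_of_le_one (by norm_num) (by norm_num) hkl
      show (1/8:ℝ)^l / 8 ≤ (1/8:ℝ)^k / 8
      linarith)
  have hgK : ∀ k, g k ∈ K k := fun k => (hg k).1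
  have hgC : ∀ k, ContDiff ℝ 1 (g k) := fun k => (hgK k).1
  have hgL : ∀ k p, ‖fderiv ℝ (g k) p‖ ≤ L := fun k => (hgK k).2.2.1
  let bad : ℕ → Set E := fun k => {p | (1/2:ℝ)^k ≤ ‖fderiv ℝ (g k) p - fderiv ℝ (g (k+1)) p‖}
  have hbadm : ∀ k, MeasurableSet (bad k) := fun k =>
    (isClosed_le continuous_const ((cont _ (hgC k)).sub (cont _ (hgC (k+1)))).norm).measurableSet
  have hbad : ∀ k, ν.real (bad k) ≤ (1/2:ℝ)^k := by
    intro k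
    have h1 := (hg k).2
    have h2 : Q (g k - g (k+1)) = ∫ p, ‖fderiv ℝ (g k) p - fderiv ℝ (g (k+1)) p‖ ^ 2 ∂ν := by
      simp only [Q]
      refine integral_congr_ae (Eventually.of_forall fun p => ?_)
      show ‖fderiv ℝ (g k - g (k+1)) p‖ ^ 2 = _
      rw [fderiv_sub (dif _ (hgC k) p) (dif _ (hgC (k+1)) p)]
    have h3 := mul_meas_ge_le_integral_of_nonneg (μ := ν)
      (f := fun p => ‖fderiv ℝ (g k) p - fderiv ℝ (g (k+1)) p‖ ^ 2)
      (Eventually.of_forall fun p => by positivity)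
      (hint (fun p => fderiv ℝ (g k) p - fderiv ℝ (g (k+1)) p) (L + L)
        ((cont _ (hgC k)).sub (cont _ (hgC (k+1))))
        (fun p => (norm_sub_le _ _).trans (add_le_add (hgL k p) (hgL (k+1) p)))) ((1/4:ℝ)^k)
    have h4 : bad k = {p | (1/4:ℝ)^k ≤ ‖fderiv ℝ (g k) p - fderiv ℝ (g (k+1)) p‖ ^ 2} := by
      ext p
      simp only [bad, mem_setOf_eq]
      have : (1/4:ℝ)^k = ((1/2:ℝ)^k)^2 := by rw [← pow_mul, mul_comm, pow_mul]; norm_num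
      rw [this]
      exact (pow_le_pow_iff_left₀ (by positivity) (norm_nonneg _) (by norm_num)).symm
    rw [← h4, ← h2] at h3
    have h5 : (1/4:ℝ)^k * ν.real (bad k) ≤ (1/4:ℝ)^k * (1/2:ℝ)^k := by
      calc _ ≤ _ := h3
        _ ≤ 8 * ((1/8:ℝ)^k / 8) := h1
        _ = _ := by rw [← mul_pow]; norm_num; ring
    exact le_of_mul_le_mul_left h5 (by positivity)
  set T := ν.real univ with hT
  have hT0 : 0 ≤ T := measureReal_nonneg
  set c2 := c / (2 * (T + 1)) with hc2
  have hc20 : 0 < c2 := by positivity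
  set m := c / (2 * (L * ‖e‖ + 1)) with hm
  have hm0 : 0 < m := by positivity
  have hgood : ∀ k, m ≤ ν.real {p | c2 ≤ fderiv ℝ (g k) p e} := by
    intro k
    set A := {p | c2 ≤ fderiv ℝ (g k) p e} with hA
    have hcg := cont _ (hgC k)
    have hAm : MeasurableSet A := (isClosed_le continuous_const (by fun_prop)).measurableSet
    have h1 := (hgK k).2.2.2
    have h2 : ∫ p, fderiv ℝ (g k) p e ∂ν ≤ ∫ p, (c2 + A.indicator (fun _ => L * ‖e‖) p) ∂ν := by
      refine integral_mono (hinte _ (hgC k) (hgL k)) ((integrable_const _).add ((integrable_const _).indicator hAm)) fun p => ?_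
      by_cases hp : p ∈ A
      · simp only [indicator_of_mem hp]
        have := (le_abs_self _).trans ((fderiv ℝ (g k) p).le_opNorm e)
        have h3 : ‖fderiv ℝ (g k) p‖ * ‖e‖ ≤ L * ‖e‖ := by gcongr; exact hgL k p
        linarith
      · simp only [indicator_of_notMem hp, add_zero]
        exact (not_le.1 hp).le
    rw [integral_add (integrable_const _) ((integrable_const _).indicator hAm), integral_const,
      integral_indicator_const _ hAm, smul_eq_mul, smul_eq_mul, ← hT] at h2
    have h3 : T * c2 ≤ c / 2 := by
      rw [hc2, ← mul_div_assoc, div_le_div_iff₀ (by positivity) (by norm_num)]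
      nlinarith
    have h4 : c / 2 ≤ ν.real A * (L * ‖e‖ + 1) := by
      nlinarith [measureReal_nonneg (μ := ν) (s := A)]
    rw [hm, div_le_iff₀ (by positivity)]
    linarith
  obtain ⟨N, hN⟩ := exists_pow_lt_of_lt_one
    (show 0 < min (m / 2) (c2 / 2 / (‖e‖ + 1) / 2) by positivity) (show (1/2:ℝ) < 1 by norm_num)
  have hN1 := hN.trans_le (min_le_left _ _)
  have hN2 := hN.trans_le (min_le_right _ _)
  set Bad := ⋃ k, bad (N + k) with hBad
  have hBadν : ν Bad ≤ ENNReal.ofReal (2 * (1/2:ℝ)^N) := by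
    refine (measure_iUnion_le _).trans ?_
    have hsum : HasSum (fun k : ℕ => (1/2:ℝ)^(N+k)) (2 * (1/2:ℝ)^N) := by
      have := (hasSum_geometric_two).mul_left ((1/2:ℝ)^N)
      simp_rw [← pow_add] at this
      rwa [mul_comm] at this
    rw [← hsum.tsum_eq, ENNReal.ofReal_tsum_of_nonneg (fun k => by positivity) hsum.summable]
    refine ENNReal.tsum_le_tsum fun k => ?_
    rw [← ofReal_measureReal]
    exact ENNReal.ofReal_le_ofReal (hbad _)
  set A := {p | c2 ≤ fderiv ℝ (g N) p e} with hA
  have hAm : MeasurableSet A := by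
    have hcg := cont _ (hgC N)
    exact (isClosed_le continuous_const (by fun_prop)).measurableSet
  have hclose : ∀ p, p ∉ Bad → ∀ i j, ‖fderiv ℝ (g (N+i)) p - fderiv ℝ (g (N+i+j)) p‖ ≤
      2 * (1/2:ℝ)^(N+i) - 2 * (1/2:ℝ)^(N+i+j) := by
    intro p hp i j
    induction j with
    | zero => simp
    | succ j ih =>
      have h1 : ‖fderiv ℝ (g (N+i+j)) p - fderiv ℝ (g (N+i+j+1)) p‖ < (1/2:ℝ)^(N+i+j) := by
        by_contra hcon
        exact hp (mem_iUnion.2 ⟨i+j, by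
          simp only [bad, mem_setOf_eq]
          rw [← add_assoc]; exact not_lt.1 hcon⟩)
      have h2 := norm_sub_le_norm_sub_add_norm_sub (fderiv ℝ (g (N+i)) p) (fderiv ℝ (g (N+i+j)) p) (fderiv ℝ (g (N+i+j+1)) p)
      rw [← add_assoc, pow_succ]
      linarith
  have hclose' : ∀ p, p ∉ Bad → ∀ i j, i ≤ j → ‖fderiv ℝ (g (N+i)) p - fderiv ℝ (g (N+j)) p‖ ≤
      2 * (1/2:ℝ)^(N+i) := by
    intro p hp i j hij
    obtain ⟨l, rfl⟩ := Nat.exists_eq_add_of_le hij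
    have := hclose p hp i l
    rw [← add_assoc]
    have h0 : 0 ≤ (1/2:ℝ)^(N+i+l) := by positivity
    linarith
  refine ⟨fun k => g (N + k), A \ Bad, hAm.diff (MeasurableSet.iUnion fun k => hbadm _), ?_,
    c2 / 2 / (‖e‖ + 1), by positivity, fun k => hgC _, fun k => hgL _, ?_, ?_, ?_⟩
  · have h1 : ν Bad < ν A := by
      refine hBadν.trans_lt ?_
      rw [← ofReal_measureReal (μ := ν) (s := A)]
      rw [ENNReal.ofReal_lt_ofReal_iff (hm0.trans_le (hgood N))]
      linarith [hgood N]
    exact (tsub_pos_of_lt h1).trans_le le_measure_diff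
  · intro ε hε
    obtain ⟨N', hN'⟩ := exists_nat_one_div_lt hε
    refine ⟨N', fun k hk p => ((hgK (N+k)).2.1 p).trans (le_trans ?_ hN'.le)⟩
    apply one_div_le_one_div_of_le
    · positivity
    · have : (N':ℝ) ≤ ((N + k : ℕ) : ℝ) := by exact_mod_cast hk.trans (Nat.le_add_left _ _)
      linarith
  · rintro k p ⟨hpA, hpB⟩
    have h1 := hclose' p hpB 0 k (Nat.zero_le _)
    simp only [add_zero] at h1
    have hpA : c2 ≤ fderiv ℝ (g N) p e := hpA
    have h3 : (fderiv ℝ (g N) p - fderiv ℝ (g (N+k)) p) e ≤ 2 * (1/2:ℝ)^N * ‖e‖ :=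
      (le_abs_self _).trans (((fderiv ℝ (g N) p - fderiv ℝ (g (N+k)) p).le_opNorm e).trans (by gcongr))
    rw [ContinuousLinearMap.sub_apply] at h3
    have h4 := (le_abs_self _).trans ((fderiv ℝ (g (N+k)) p).le_opNorm e)
    have h5 : 2 * (1/2:ℝ)^N * ‖e‖ ≤ c2 / 2 := by
      rw [lt_div_iff₀ (by norm_num), lt_div_iff₀ (by positivity)] at hN2
      have : 0 < (1/2:ℝ)^N := by positivity
      nlinarith
    rw [div_le_iff₀ (by positivity)]
    nlinarith [norm_nonneg (fderiv ℝ (g (N+k)) p)]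
  · intro ε hε
    obtain ⟨N', hN'⟩ := exists_pow_lt_of_lt_one (half_pos hε) (show (1/2:ℝ) < 1 by norm_num)
    have key : ∀ k l, N' ≤ k → k ≤ l → ∀ p, p ∉ Bad → ‖fderiv ℝ (g (N+k)) p - fderiv ℝ (g (N+l)) p‖ ≤ ε := by
      intro k l hk hkl p hp
      have h1 := hclose' p hp k l hkl
      have h2 : (1/2:ℝ)^(N+k) ≤ (1/2:ℝ)^N' :=
        pow_le_pow_of_le_one (by norm_num) (by norm_num) (hk.trans (Nat.le_add_left _ _))
      linarith
    refine ⟨N', fun k hk l hl p hp => ?_⟩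
    rcases le_total k l with hkl | hkl
    · exact key k l hk hkl p hp.2
    · rw [norm_sub_rev]; exact key l k hl hkl p hp.2

lemma flat_one (E0 : Set (EuclideanSpace ℝ (Fin 1))) (hE0 : IsCompact E0) (hv : volume E0 = 0)
    (ν : Measure (EuclideanSpace ℝ (Fin 1))) [IsFiniteMeasure ν] (hν : 0 < ν E0) :
    ∃ e : EuclideanSpace ℝ (Fin 1), ∃ c > (0:ℝ), ∃ L : ℝ, 0 ≤ L ∧ ∀ ε > (0:ℝ),
      ∃ g : EuclideanSpace ℝ (Fin 1) → ℝ, ContDiff ℝ 1 g ∧ (∀ p, |g p| ≤ ε) ∧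
        (∀ p, ‖fderiv ℝ g p‖ ≤ L) ∧ c ≤ ∫ p, fderiv ℝ g p e ∂ν := by
  set π : EuclideanSpace ℝ (Fin 1) →L[ℝ] ℝ := EuclideanSpace.proj (0 : Fin 1) with hπ
  have hπn : ∀ p, ‖π p‖ ≤ 1 * ‖p‖ := fun p => by
    rw [one_mul]; exact PiLp.norm_apply_le p 0
  have hπ1 : ‖π‖ ≤ 1 := π.opNorm_le_bound zero_le_one hπn
  have hmp : MeasurePreserving (fun p : EuclideanSpace ℝ (Fin 1) => π p) volume volume := by
    have := (volume_preserving_funUnique (Fin 1) ℝ).comp (PiLp.volume_preserving_ofLp (Fin 1))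
    exact this
  have hinj : Function.Injective (fun p : EuclideanSpace ℝ (Fin 1) => π p) := by
    intro p q h
    ext i
    rw [Subsingleton.elim i 0]
    exact h
  set K : Set ℝ := (fun p => π p) '' E0 with hK
  have hKc : IsCompact K := hE0.image π.continuous
  have hK0 : volume K = 0 := by
    rw [← hmp.measure_preimage hKc.measurableSet.nullMeasurableSet, hK,
      preimage_image_eq _ hinj, hv]
  refine ⟨EuclideanSpace.single 0 1, ν.real E0, ?_, 1, zero_le_one, ?_⟩
  · exact ENNReal.toReal_pos hν.ne' (measure_ne_top _ _)
  intro ε hε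
  obtain ⟨O, hKO, hO, hOε⟩ := Set.exists_isOpen_lt_of_lt K (ENNReal.ofReal ε) (by rw [hK0]; simpa using hε)
  obtain ⟨ψ, h0, h1, h01⟩ := exists_continuous_zero_one_of_isClosed hO.isClosed_compl hKc.isClosed
    (by rw [Set.disjoint_compl_left_iff_subset]; exact hKO)
  have hF : ∀ x : ℝ, HasDerivAt (fun x => ∫ t in (0:ℝ)..x, ψ t) (ψ x) x := fun x =>
    intervalIntegral.integral_hasDerivAt_right (ψ.continuous.intervalIntegrable _ _)
      (ψ.continuous.stronglyMeasurableAtFilter _ _) ψ.continuous.continuousAt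
  have hFc : ContDiff ℝ 1 (fun x => ∫ t in (0:ℝ)..x, ψ t) := by
    rw [contDiff_one_iff_deriv]
    refine ⟨fun x => (hF x).differentiableAt, ?_⟩
    have : deriv (fun x => ∫ t in (0:ℝ)..x, ψ t) = ψ := by
      ext x; exact (hF x).deriv
    rw [this]; exact ψ.continuous
  have hg : ∀ p, HasFDerivAt (fun p : EuclideanSpace ℝ (Fin 1) => ∫ t in (0:ℝ)..π p, ψ t)
      (ψ (π p) • π) p := fun p => (hF (π p)).comp_hasFDerivAt p π.hasFDerivAt
  refine ⟨fun p => ∫ t in (0:ℝ)..π p, ψ t, hFc.comp π.contDiff, ?_, ?_, ?_⟩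
  · intro p
    have hle : ∀ t, ‖ψ t‖ ≤ O.indicator (fun _ => (1:ℝ)) t := by
      intro t
      by_cases ht : t ∈ O
      · rw [indicator_of_mem ht, Real.norm_of_nonneg (h01 t).1]; exact (h01 t).2
      · rw [indicator_of_notMem ht, h0 ht]; simp
    have hint : Integrable (O.indicator (fun _ => (1:ℝ))) volume := by
      rw [integrable_indicator_iff hO.measurableSet]
      exact integrableOn_const (hOε.trans_le le_top).ne
    calc |∫ t in (0:ℝ)..π p, ψ t| ≤ ∫ t in Set.uIoc 0 (π p), ‖ψ t‖ := by
          rw [← Real.norm_eq_abs]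
          exact intervalIntegral.norm_integral_le_integral_norm_uIoc
      _ ≤ ∫ t in Set.uIoc 0 (π p), O.indicator (fun _ => (1:ℝ)) t := by
          refine integral_mono_of_nonneg (ae_of_all _ fun t => norm_nonneg _) hint.integrableOn
            (ae_of_all _ hle)
      _ ≤ ∫ t, O.indicator (fun _ => (1:ℝ)) t :=
          setIntegral_le_integral hint (ae_of_all _ fun t => indicator_nonneg (fun _ _ => zero_le_one) t)
      _ = volume.real O := by
          rw [integral_indicator hO.measurableSet]; simp
      _ ≤ ε := ENNReal.toReal_le_of_le_ofReal hε.le hOε.le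
  · intro p
    rw [(hg p).fderiv, norm_smul, Real.norm_of_nonneg (h01 _).1]
    exact mul_le_one₀ (h01 _).2 (norm_nonneg _) hπ1
  · have : ∀ p, fderiv ℝ (fun p : EuclideanSpace ℝ (Fin 1) => ∫ t in (0:ℝ)..π p, ψ t) p
        (EuclideanSpace.single 0 1) = ψ (π p) := by
      intro p
      rw [(hg p).fderiv]
      simp [hπ]
    simp_rw [this]
    have hi : Integrable (fun p => ψ (π p)) ν := by
      refine Integrable.of_bound (C := 1) ((ψ.continuous.comp π.continuous).aestronglyMeasurable) ?_
      exact ae_of_all _ fun p => by rw [Real.norm_of_nonneg (h01 _).1]; exact (h01 _).2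
    calc ν.real E0 = ∫ p in E0, (1:ℝ) ∂ν := by simp
      _ = ∫ p in E0, ψ (π p) ∂ν := by
          refine setIntegral_congr_fun hE0.measurableSet fun p hp => ?_
          exact (h1 (mem_image_of_mem _ hp)).symm
      _ ≤ _ := setIntegral_le_integral hi (ae_of_all _ fun p => (h01 _).1)

open scoped Convolution in
lemma mollify {E : Type*} [NormedAddCommGroup E] [InnerProductSpace ℝ E] [FiniteDimensional ℝ E]
    [MeasurableSpace E] [BorelSpace E] (g : E → ℝ) (hg : Continuous g) {r : ℝ} (hr : 0 < r) :
    ∃ h : E → ℝ, ContDiff ℝ 1 h ∧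
      (∀ x y a, (∀ s, ‖s‖ ≤ r → a ≤ g (y - s) - g (x - s)) → a ≤ h y - h x) ∧
      (∀ x a, (∀ s, ‖s‖ ≤ r → a ≤ g (x - s)) → a ≤ h x) ∧
      (∀ x a, (∀ s, ‖s‖ ≤ r → g (x - s) ≤ a) → h x ≤ a) := by
  let b : ContDiffBump (0 : E) := ⟨r / 2, r, by positivity, by linarith⟩
  set η : E → ℝ := b.normed volume with hη
  have hηc : Continuous η := (b.contDiff_normed (n := 0)).continuous
  have hηs : HasCompactSupport η := b.hasCompactSupport_normed
  have hint : ∀ f : E → ℝ, Continuous f → Integrable (fun s => η s * f s) volume := fun f hf =>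
    (hηc.mul hf).integrable_of_hasCompactSupport (hηs.mul_right)
  have key : ∀ f : E → ℝ, Continuous f → ∀ a, (∀ s, ‖s‖ ≤ r → a ≤ f s) → a ≤ ∫ s, η s * f s := by
    intro f hf a ha
    have : ∫ s, η s * a = a := by
      rw [integral_mul_const, b.integral_normed, one_mul]
    rw [← this]
    refine integral_mono (hint _ continuous_const) (hint _ hf) fun s => ?_
    by_cases hs : ‖s‖ ≤ r
    · exact mul_le_mul_of_nonneg_left (ha s hs) (b.nonneg_normed s)
    · have : η s = 0 := by
        by_contra h
        have : s ∈ Function.support η := h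
        rw [hη, b.support_normed_eq, mem_ball_zero_iff] at this
        exact hs this.le
      simp [this]
  refine ⟨fun x => ∫ s, η s * g (x - s), ?_, ?_, ?_, ?_⟩
  · have := hηs.contDiff_convolution_left (ContinuousLinearMap.lsmul ℝ ℝ) (μ := volume) (n := 1)
      (b.contDiff_normed (n := 1)) hg.locallyIntegrable
    exact this
  · intro x y a h
    simp only
    rw [← integral_sub (hint (fun s => g (y - s)) (by fun_prop)) (hint (fun s => g (x - s)) (by fun_prop))]
    simp_rw [← mul_sub]
    exact key (fun s => g (y - s) - g (x - s)) (by fun_prop) a h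
  · intro x a h
    exact key (fun s => g (x - s)) (by fun_prop) a h
  · intro x a h
    have := key (fun s => - g (x - s)) (by fun_prop) (-a) (fun s hs => neg_le_neg (h s hs))
    simp_rw [mul_neg, integral_neg] at this
    exact neg_le_neg_iff.1 this

/-- strictly increasing chains in the integer lattice -/
def IsCh (C : Finset (ℤ × ℤ)) : Prop :=
  ∀ a ∈ C, ∀ b ∈ C, a ≠ b → (a.1 < b.1 ∧ a.2 < b.2) ∨ (b.1 < a.1 ∧ b.2 < a.2)

def uu (δ : ℝ) (q : ℤ × ℤ) (p : EuclideanSpace ℝ (Fin 2)) : ℝ :=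
  min (p 0 - δ * q.1) (p 1 - δ * q.2)

def clm (δ u : ℝ) : ℝ := max 0 (min (2 * δ) (u + δ))

def chS (δ : ℝ) (C : Finset (ℤ × ℤ)) (p : EuclideanSpace ℝ (Fin 2)) : ℝ :=
  ∑ q ∈ C, clm δ (uu δ q p)

def diagE : EuclideanSpace ℝ (Fin 2) := !₂[1, 1]

open Classical in
lemma chN (P : Finset (ℤ × ℤ)) : (P.powerset.filter IsCh).Nonempty :=
  ⟨∅, by simp [IsCh]⟩

open Classical in
noncomputable def chG (δ : ℝ) (P : Finset (ℤ × ℤ)) (p : EuclideanSpace ℝ (Fin 2)) : ℝ :=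
  (P.powerset.filter IsCh).sup' (chN P) (fun C => chS δ C p)

lemma le_chG {δ : ℝ} {P C : Finset (ℤ × ℤ)} (h : C ⊆ P) (hC : IsCh C)
    (p : EuclideanSpace ℝ (Fin 2)) : chS δ C p ≤ chG δ P p := by
  classical
  unfold chG
  exact Finset.le_sup' (fun C => chS δ C p) (by simp [h, hC])

lemma exists_chG (δ : ℝ) (P : Finset (ℤ × ℤ)) (p : EuclideanSpace ℝ (Fin 2)) :
    ∃ C ⊆ P, IsCh C ∧ chG δ P p = chS δ C p := by
  classical
  obtain ⟨C, hC, h⟩ := Finset.exists_mem_eq_sup' (chN P) (fun C => chS δ C p)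
  simp only [Finset.mem_filter, Finset.mem_powerset] at hC
  exact ⟨C, hC.1, hC.2, by unfold chG; convert h⟩

lemma clm_nonneg (δ u : ℝ) : 0 ≤ clm δ u := le_max_left _ _

lemma clm_le {δ : ℝ} (hδ : 0 < δ) (u : ℝ) : clm δ u ≤ 2 * δ :=
  max_le (by linarith) (min_le_left _ _)

lemma clm_mono (δ : ℝ) {u v : ℝ} (h : u ≤ v) : clm δ u ≤ clm δ v := by
  unfold clm; gcongr

lemma clm_lip (δ u v t : ℝ) (ht : 0 ≤ t) (h : u ≤ v + t) : clm δ u ≤ clm δ v + t := by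
  unfold clm
  refine max_le (by have := le_max_left 0 (min (2 * δ) (v + δ)); linarith) ?_
  refine le_trans ?_ (add_le_add_left (le_max_right 0 (min (2 * δ) (v + δ))) t)
  rw [← min_add_add_right]
  exact min_le_min (by linarith) (by linarith)

lemma clm_eq {δ u : ℝ} (h1 : -δ ≤ u) (h2 : u ≤ δ) : clm δ u = u + δ := by
  unfold clm
  rw [min_eq_right (by linarith), max_eq_right (by linarith)]

lemma clm_top {δ u : ℝ} (hδ : 0 < δ) (h2 : δ ≤ u) : clm δ u = 2 * δ := by
  unfold clm
  rw [min_eq_left (by linarith), max_eq_right (by linarith)]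

lemma clm_bot {δ u : ℝ} (hδ : 0 < δ) (h2 : u ≤ -δ) : clm δ u = 0 := by
  unfold clm
  rw [min_eq_right (by linarith), max_eq_left (by linarith)]

lemma uu_lip (δ : ℝ) (q : ℤ × ℤ) (p p' : EuclideanSpace ℝ (Fin 2)) :
    uu δ q p ≤ uu δ q p' + ‖p - p'‖ := by
  have h0 := PiLp.norm_apply_le (p - p') 0
  have h1 := PiLp.norm_apply_le (p - p') 1
  simp only [PiLp.sub_apply, Real.norm_eq_abs] at h0 h1
  have h0' := (abs_le.1 h0).2
  have h1' := (abs_le.1 h1).2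
  unfold uu
  rw [← min_add_add_right]
  exact min_le_min (by linarith) (by linarith)

lemma uu_add (δ : ℝ) (q : ℤ × ℤ) (p : EuclideanSpace ℝ (Fin 2)) (t : ℝ) :
    uu δ q (p + t • diagE) = uu δ q p + t := by
  unfold uu diagE
  rw [← min_add_add_right]
  simp
  congr 1 <;> ring

lemma uu_sep {δ : ℝ} (hδ : 0 < δ) {a b : ℤ × ℤ} (h : a.1 < b.1 ∧ a.2 < b.2)
    (p : EuclideanSpace ℝ (Fin 2)) : uu δ b p + δ ≤ uu δ a p := by
  have h1 : ((a.1 + 1 : ℤ) : ℝ) ≤ (b.1 : ℝ) := by exact_mod_cast h.1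
  have h2 : ((a.2 + 1 : ℤ) : ℝ) ≤ (b.2 : ℝ) := by exact_mod_cast h.2
  push_cast at h1 h2
  unfold uu
  rw [← min_add_add_right]
  exact min_le_min (by nlinarith) (by nlinarith)

lemma chS_lip {δ : ℝ} (hδ : 0 < δ) {C : Finset (ℤ × ℤ)} (hC : IsCh C)
    (p p' : EuclideanSpace ℝ (Fin 2)) (h : ‖p - p'‖ ≤ δ) :
    chS δ C p ≤ chS δ C p' + 5 * ‖p - p'‖ := by
  classical
  set t := ‖p - p'‖ with ht
  have ht0 : 0 ≤ t := norm_nonneg _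
  set A := C.filter (fun q => -(2 * δ) ≤ uu δ q p ∧ uu δ q p ≤ 2 * δ) with hA
  have hcard : A.card ≤ 5 := by
    have : A.card ≤ (Finset.Icc (-2 : ℤ) 2).card := by
      refine Finset.card_le_card_of_injOn (fun q => ⌊uu δ q p / δ⌋) ?_ ?_
      · intro q hq
        simp only [hA, Finset.coe_filter, mem_ofPred_eq] at hq
        simp only [Finset.coe_Icc, mem_Icc]
        constructor
        · rw [Int.le_floor, le_div_iff₀ hδ]; push_cast; linarith [hq.2.1]
        · have : uu δ q p / δ < ((3 : ℤ) : ℝ) := by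
            rw [div_lt_iff₀ hδ]; push_cast; linarith [hq.2.2]
          have := Int.floor_lt.2 this
          omega
      · intro a ha b hb hab
        by_contra hne
        simp only [hA, Finset.coe_filter, mem_ofPred_eq] at ha hb
        have key : ∀ a b : ℤ × ℤ, (a.1 < b.1 ∧ a.2 < b.2) → ⌊uu δ b p / δ⌋ + 1 ≤ ⌊uu δ a p / δ⌋ := by
          intro a b hab
          have := uu_sep hδ hab p
          rw [← Int.floor_add_one]
          apply Int.floor_mono
          rw [div_add_one hδ.ne']
          gcongr
        simp only at hab
        rcases hC a ha.1 b hb.1 hne with h | h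
        · have := key _ _ h; omega
        · have := key _ _ h; omega
    simpa using this
  have : ∀ q ∈ C, clm δ (uu δ q p) ≤ clm δ (uu δ q p') + if q ∈ A then t else 0 := by
    intro q hq
    by_cases hqA : q ∈ A
    · rw [if_pos hqA]
      exact clm_lip _ _ _ _ ht0 (uu_lip δ q p p')
    · rw [if_neg hqA, add_zero]
      have : ¬ (-(2 * δ) ≤ uu δ q p ∧ uu δ q p ≤ 2 * δ) := fun h => hqA (by simp [hA, hq, h])
      by_cases h1 : -(2 * δ) ≤ uu δ q p
      · have h2 : 2 * δ < uu δ q p := by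
          by_contra h2; exact this ⟨h1, not_lt.1 h2⟩
        have := uu_lip δ q p p'
        rw [clm_top hδ (u := uu δ q p') (by linarith)]
        exact clm_le hδ _
      · rw [clm_bot hδ (by linarith)]; exact clm_nonneg _ _
  calc chS δ C p ≤ ∑ q ∈ C, (clm δ (uu δ q p') + if q ∈ A then t else 0) := Finset.sum_le_sum this
    _ = chS δ C p' + A.card * t := by
        rw [Finset.sum_add_distrib, ← Finset.sum_filter, Finset.sum_const, nsmul_eq_mul]
        have : C.filter (fun q => q ∈ A) = A := by
          ext q; simp [hA]
        rw [this]; rfl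
    _ ≤ chS δ C p' + 5 * t := by
        have : (A.card : ℝ) ≤ 5 := by exact_mod_cast hcard
        gcongr

lemma chG_lip {δ : ℝ} (hδ : 0 < δ) (P : Finset (ℤ × ℤ))
    (p p' : EuclideanSpace ℝ (Fin 2)) (h : ‖p - p'‖ ≤ δ) :
    chG δ P p ≤ chG δ P p' + 5 * ‖p - p'‖ := by
  obtain ⟨C, hCP, hC, he⟩ := exists_chG δ P p
  rw [he]
  exact (chS_lip hδ hC p p' h).trans (by gcongr; exact le_chG hCP hC p')

lemma chG_cont {δ : ℝ} (hδ : 0 < δ) (P : Finset (ℤ × ℤ)) : Continuous (chG δ P) := by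
  rw [continuous_iff_continuousAt]
  intro p
  refine continuousAt_of_locally_lipschitz hδ 5 fun y hy => ?_
  rw [dist_eq_norm] at hy ⊢
  rw [dist_eq_norm]
  have h1 := chG_lip hδ P y p hy.le
  have h2 := chG_lip hδ P p y (by rw [norm_sub_rev]; exact hy.le)
  rw [norm_sub_rev p y] at h2
  rw [Real.norm_eq_abs, abs_le]
  constructor <;> linarith

lemma chG_mono {δ : ℝ} (P : Finset (ℤ × ℤ)) (p : EuclideanSpace ℝ (Fin 2)) {t : ℝ}
    (ht : 0 ≤ t) : chG δ P p ≤ chG δ P (p + t • diagE) := by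
  obtain ⟨C, hCP, hC, he⟩ := exists_chG δ P p
  rw [he]
  refine le_trans ?_ (le_chG hCP hC _)
  refine Finset.sum_le_sum fun q _ => clm_mono _ ?_
  rw [uu_add]; linarith

lemma chG_local {δ : ℝ} (hδ : 0 < δ) (P : Finset (ℤ × ℤ)) {q : ℤ × ℤ} (hq : q ∈ P)
    (p : EuclideanSpace ℝ (Fin 2)) (h0 : |p 0 - δ * q.1| < δ) (h1 : |p 1 - δ * q.2| < δ) :
    ∃ τ > 0, ∀ t, 0 ≤ t → t ≤ τ → chG δ P p + t ≤ chG δ P (p + t • diagE) := by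
  classical
  rw [abs_lt] at h0 h1
  obtain ⟨C, hCP, hC, he⟩ := exists_chG δ P p
  rw [he]
  by_cases hp : ∃ c ∈ C, -δ ≤ uu δ c p ∧ uu δ c p < δ
  · obtain ⟨c, hc, hc1, hc2⟩ := hp
    refine ⟨δ - uu δ c p, by linarith, fun t ht0 ht => ?_⟩
    refine le_trans ?_ (le_chG hCP hC _)
    unfold chS
    rw [← Finset.add_sum_erase _ _ hc, ← Finset.add_sum_erase _ _ hc, uu_add,
      clm_eq hc1 hc2.le, clm_eq (by linarith) (by linarith)]
    have : ∑ x ∈ C.erase c, clm δ (uu δ x p) ≤ ∑ x ∈ C.erase c, clm δ (uu δ x (p + t • diagE)) := by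
      refine Finset.sum_le_sum fun q _ => clm_mono _ ?_
      rw [uu_add]; linarith
    linarith
  · push Not at hp
    set D := C.filter (fun c => δ ≤ uu δ c p) with hD
    have hlt : ∀ c ∈ D, c.1 < q.1 ∧ c.2 < q.2 := by
      intro c hc
      simp only [hD, Finset.mem_filter, uu, le_min_iff] at hc
      constructor
      · have : δ * (c.1 : ℝ) < δ * q.1 := by linarith [hc.2.1]
        exact_mod_cast lt_of_mul_lt_mul_left this hδ.le
      · have : δ * (c.2 : ℝ) < δ * q.2 := by linarith [hc.2.2]
        exact_mod_cast lt_of_mul_lt_mul_left this hδ.le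
    have hqD : q ∉ D := fun h => lt_irrefl _ (hlt q h).1
    have hDC : ∀ c ∈ D, c ∈ C := fun c hc => (Finset.mem_filter.1 hc).1
    have hch : IsCh (insert q D) := by
      intro a ha b hb hab
      rcases Finset.mem_insert.1 ha with ha1 | ha1 <;> rcases Finset.mem_insert.1 hb with hb1 | hb1
      · exact absurd (ha1.trans hb1.symm) hab
      · rw [ha1]; exact Or.inr (hlt b hb1)
      · rw [hb1]; exact Or.inl (hlt a ha1)
      · exact hC a (hDC a ha1) b (hDC b hb1) hab
    have hu1 : -δ < uu δ q p := lt_min h0.1 h1.1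
    have hu2 : uu δ q p < δ := (min_le_left _ _).trans_lt h0.2
    refine ⟨δ - uu δ q p, by linarith, fun t ht0 ht => ?_⟩
    refine le_trans ?_ (le_chG (C := insert q D) ?_ hch _)
    · unfold chS
      rw [Finset.sum_insert hqD, uu_add, clm_eq (u := uu δ q p + t) (by linarith) (by linarith)]
      have : ∑ x ∈ C, clm δ (uu δ x p) ≤ ∑ x ∈ D, clm δ (uu δ x (p + t • diagE)) := by
        rw [hD, Finset.sum_filter]
        refine Finset.sum_le_sum fun c hc => ?_
        split_ifs with h
        · refine clm_mono _ ?_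
          rw [uu_add]; linarith
        · rw [clm_bot hδ]
          by_contra h'
          exact h (hp c hc (by linarith))
      linarith
    · intro x hx
      rcases Finset.mem_insert.1 hx with rfl | hx
      · exact hq
      · exact hCP (hDC x hx)

lemma chG_global {δ : ℝ} (hδ : 0 < δ) (P : Finset (ℤ × ℤ)) {q : ℤ × ℤ} (hq : q ∈ P)
    (p : EuclideanSpace ℝ (Fin 2)) {T : ℝ} (hT : 0 ≤ T)
    (h0 : |p 0 - δ * q.1| + T < δ) (h1 : |p 1 - δ * q.2| + T < δ) :
    chG δ P p + T ≤ chG δ P (p + T • diagE) := by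
  have hsub : Icc 0 T ⊆ {t | chG δ P p + t ≤ chG δ P (p + t • diagE)} := by
    apply IsClosed.Icc_subset_of_forall_exists_gt
    · refine IsClosed.inter ?_ isClosed_Icc
      exact isClosed_le (by fun_prop) ((chG_cont hδ P).comp (by fun_prop))
    · simp
    · rintro x ⟨hx, hx0, hxT⟩ y hy
      simp only [mem_ofPred_eq] at hx
      have hc0 : |(p + x • diagE) 0 - δ * q.1| < δ := by
        have : (p + x • diagE) 0 - δ * q.1 = (p 0 - δ * q.1) + x := by simp [diagE]; ring
        rw [this]
        refine (abs_add_le _ _).trans_lt ?_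
        rw [abs_of_nonneg hx0]; linarith
      have hc1 : |(p + x • diagE) 1 - δ * q.2| < δ := by
        have : (p + x • diagE) 1 - δ * q.2 = (p 1 - δ * q.2) + x := by simp [diagE]; ring
        rw [this]
        refine (abs_add_le _ _).trans_lt ?_
        rw [abs_of_nonneg hx0]; linarith
      obtain ⟨τ, hτ, h⟩ := chG_local hδ P hq _ hc0 hc1
      simp only [mem_Ioi] at hy
      refine ⟨x + min τ (y - x), ?_, ?_, ?_⟩
      · simp only [mem_ofPred_eq]
        have := h (min τ (y - x)) (by have := sub_pos.2 hy; positivity) (min_le_left _ _)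
        rw [add_assoc, ← add_smul] at this
        linarith
      · have : 0 < min τ (y - x) := lt_min hτ (sub_pos.2 hy)
        linarith
      · have := min_le_right τ (y - x); linarith
  exact hsub ⟨hT, le_rfl⟩

lemma chG_bounds {δ : ℝ} (hδ : 0 < δ) (P : Finset (ℤ × ℤ)) {k : ℝ}
    (hk : ∀ C ⊆ P, IsCh C → (C.card : ℝ) ≤ k) (p : EuclideanSpace ℝ (Fin 2)) :
    0 ≤ chG δ P p ∧ chG δ P p ≤ 2 * δ * k := by
  obtain ⟨C, hCP, hC, he⟩ := exists_chG δ P p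
  rw [he]
  refine ⟨Finset.sum_nonneg fun q _ => clm_nonneg _ _, ?_⟩
  calc chS δ C p ≤ ∑ q ∈ C, 2 * δ := Finset.sum_le_sum fun q _ => clm_le hδ _
    _ = 2 * δ * C.card := by rw [Finset.sum_const, nsmul_eq_mul, mul_comm]
    _ ≤ _ := by gcongr; exact hk C hCP hC

lemma fderiv_ge {E : Type*} [NormedAddCommGroup E] [NormedSpace ℝ E] {h : E → ℝ} {x e : E}
    (hd : DifferentiableAt ℝ h x) {a τ : ℝ} (hτ : 0 < τ)
    (H : ∀ t, 0 < t → t < τ → a * t ≤ h (x + t • e) - h x) : a ≤ fderiv ℝ h x e := by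
  have h1 : HasDerivAt (fun t : ℝ => h (x + t • e)) (fderiv ℝ h x e) 0 := by
    have := hd.hasFDerivAt.hasLineDerivAt e
    exact this
  have h2 := (hasDerivAt_iff_tendsto_slope_zero.1 h1).mono_left
    (nhdsWithin_mono (0:ℝ) (fun t (ht : t ∈ Ioi (0:ℝ)) => ne_of_gt ht))
  refine ge_of_tendsto h2 ?_
  filter_upwards [Ioo_mem_nhdsGT hτ] with t ht
  have := H t ht.1 ht.2
  simp only [zero_add, zero_smul, add_zero, smul_eq_mul]
  rw [inv_mul_eq_div, le_div_iff₀ ht.1]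
  exact this

lemma chain_fun {δ : ℝ} (hδ : 0 < δ) (P : Finset (ℤ × ℤ)) {k : ℝ}
    (hk : ∀ C ⊆ P, IsCh C → (C.card : ℝ) ≤ k) :
    ∃ h : EuclideanSpace ℝ (Fin 2) → ℝ, ContDiff ℝ 1 h ∧ (∀ p, |h p| ≤ 2 * δ * k) ∧
      (∀ p, ‖fderiv ℝ h p‖ ≤ 5) ∧ (∀ p, 0 ≤ fderiv ℝ h p diagE) ∧
      ∀ q ∈ P, ∀ p : EuclideanSpace ℝ (Fin 2), |p 0 - δ * q.1| ≤ δ / 2 → |p 1 - δ * q.2| ≤ δ / 2 →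
        1 ≤ fderiv ℝ h p diagE := by
  obtain ⟨h, hc, hdiff, hlo, hhi⟩ := mollify (chG δ P) (chG_cont hδ P) (r := δ / 4) (by positivity)
  have hd : Differentiable ℝ h := hc.differentiable one_ne_zero
  have hcomm : ∀ (x s : EuclideanSpace ℝ (Fin 2)) (t : ℝ), x + t • diagE - s = (x - s) + t • diagE :=
    fun x s t => by abel
  refine ⟨h, hc, ?_, ?_, ?_, ?_⟩
  · intro p
    rw [abs_le]
    have h1 := hlo p 0 fun s _ => (chG_bounds hδ P hk _).1
    have h2 := hhi p (2 * δ * k) fun s _ => (chG_bounds hδ P hk _).2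
    constructor <;> linarith
  · intro p
    refine (hd p).hasFDerivAt.le_of_lip' (by norm_num) ?_
    filter_upwards [closedBall_mem_nhds p hδ] with x hx
    rw [mem_closedBall, dist_eq_norm] at hx
    have key : ∀ x p : EuclideanSpace ℝ (Fin 2), ‖x - p‖ ≤ δ → -(5 * ‖x - p‖) ≤ h x - h p := by
      intro x p hx
      refine hdiff _ _ _ fun s _ => ?_
      have he : p - s - (x - s) = -(x - p) := by abel
      have := chG_lip hδ P (p - s) (x - s) (by rw [he, norm_neg]; exact hx)
      rw [he, norm_neg] at this
      linarith
    rw [Real.norm_eq_abs, abs_le]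
    have h1 := key x p hx
    have h2 := key p x (by rw [norm_sub_rev]; exact hx)
    rw [norm_sub_rev p x] at h2
    constructor <;> linarith
  · intro p
    refine fderiv_ge (hd p) one_pos fun t ht _ => ?_
    rw [zero_mul]
    refine hdiff _ _ _ fun s _ => ?_
    rw [hcomm]
    exact sub_nonneg.2 (chG_mono P _ ht.le)
  · intro q hq p h0 h1
    refine fderiv_ge (hd p) (τ := δ / 8) (by positivity) fun t ht ht8 => ?_
    rw [one_mul]
    refine hdiff _ _ _ fun s hs => ?_
    rw [hcomm]
    have hs0 := (PiLp.norm_apply_le s 0).trans hs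
    have hs1 := (PiLp.norm_apply_le s 1).trans hs
    rw [Real.norm_eq_abs] at hs0 hs1
    have := chG_global hδ P hq (p - s) ht.le ?_ ?_
    · linarith
    · have : (p - s) 0 - δ * q.1 = (p 0 - δ * q.1) - s 0 := by simp; ring
      rw [this]
      have := abs_sub (p 0 - δ * q.1) (s 0)
      linarith
    · have : (p - s) 1 - δ * q.2 = (p 1 - δ * q.2) - s 1 := by simp; ring
      rw [this]
      have := abs_sub (p 1 - δ * q.2) (s 1)
      linarith

def IsRv (C : Finset (ℤ × ℤ)) : Prop :=
  ∀ a ∈ C, ∀ b ∈ C, a ≠ b → (a.1 < b.1 ∧ b.2 < a.2) ∨ (b.1 < a.1 ∧ a.2 < b.2)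

lemma chain_split (k : ℕ) (N : ℕ) : ∀ P : Finset (ℤ × ℤ), P.card ≤ N → ∃ A B : Finset (ℤ × ℤ), A ∪ B = P ∧
    (∀ C ⊆ B, IsCh C → C.card ≤ k) ∧ (∀ C ⊆ A, IsRv C → C.card * k ≤ P.card) := by
  classical
  induction N with
  | zero =>
    intro P hP
    have : P = ∅ := Finset.card_eq_zero.1 (by omega)
    subst this
    refine ⟨∅, ∅, by simp, ?_, ?_⟩
    · intro C hC _; simp [Finset.subset_empty.1 hC]
    · intro C hC _; simp [Finset.subset_empty.1 hC]
  | succ N ih =>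
    intro P hP
    by_cases h : ∀ C ⊆ P, IsCh C → C.card ≤ k
    · refine ⟨∅, P, by simp, h, ?_⟩
      intro C hC _; simp [Finset.subset_empty.1 hC]
    · push Not at h
      obtain ⟨C0, hC0P, hC0, hk⟩ := h
      have hcard : (P \ C0).card + C0.card = P.card := Finset.card_sdiff_add_card_eq_card hC0P
      obtain ⟨A, B, hAB, hB, hA⟩ := ih (P \ C0) (by omega)
      refine ⟨A ∪ C0, B, ?_, hB, ?_⟩
      · rw [Finset.union_right_comm, hAB, Finset.sdiff_union_of_subset hC0P]
      · intro C hC hrv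
        have h1 : (C ∩ C0).card ≤ 1 := by
          rw [Finset.card_le_one]
          intro a ha b hb
          by_contra hne
          rw [Finset.mem_inter] at ha hb
          have h1 := hrv a ha.1 b hb.1 hne
          have h2 := hC0 a ha.2 b hb.2 hne
          omega
        have h2 := hA (C \ C0) (fun x hx => by
          rw [Finset.mem_sdiff] at hx
          rcases Finset.mem_union.1 (hC hx.1) with h | h
          · exact h
          · exact absurd h hx.2)
          (fun a ha b hb => hrv a (Finset.mem_sdiff.1 ha).1 b (Finset.mem_sdiff.1 hb).1)
        have h3 : (C \ C0).card + (C ∩ C0).card = C.card := Finset.card_sdiff_add_card_inter C C0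
        have h4 : (C ∩ C0).card * k ≤ 1 * k := Nat.mul_le_mul_right _ h1
        rw [← h3, add_mul]
        omega

lemma box_volume {δ : ℝ} (hδ : 0 < δ) (q : ℤ × ℤ) :
    MeasurableSet {x : EuclideanSpace ℝ (Fin 2) | (round (x 0 / δ), round (x 1 / δ)) = q} ∧
    volume {x : EuclideanSpace ℝ (Fin 2) | (round (x 0 / δ), round (x 1 / δ)) = q}
      = ENNReal.ofReal (δ ^ 2) := by
  have hround : ∀ (x : ℝ) (m : ℤ), round (x / δ) = m ↔ x ∈ Ico (δ * (m - 1 / 2)) (δ * (m + 1 / 2)) := by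
    intro x m
    rw [round_eq, Int.floor_eq_iff, mem_Ico]
    constructor
    · rintro ⟨h1, h2⟩
      have h1' : (m : ℝ) - 1 / 2 ≤ x / δ := by linarith
      have h2' : x / δ < m + 1 / 2 := by linarith
      rw [le_div_iff₀ hδ] at h1'
      rw [div_lt_iff₀ hδ] at h2'
      constructor <;> linarith
    · rintro ⟨h1, h2⟩
      have h1' : (m : ℝ) - 1 / 2 ≤ x / δ := by rw [le_div_iff₀ hδ]; linarith
      have h2' : x / δ < m + 1 / 2 := by rw [div_lt_iff₀ hδ]; linarith
      constructor <;> linarith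
  have hset : {x : EuclideanSpace ℝ (Fin 2) | (round (x 0 / δ), round (x 1 / δ)) = q}
      = (fun x : EuclideanSpace ℝ (Fin 2) => x.ofLp) ⁻¹' (Set.pi univ fun i =>
        Ico (δ * ((![q.1, q.2] i : ℤ) - 1 / 2)) (δ * ((![q.1, q.2] i : ℤ) + 1 / 2))) := by
    ext x
    simp only [mem_ofPred_eq, Prod.ext_iff, hround, mem_preimage, Set.mem_pi, mem_univ, true_implies,
      Fin.forall_fin_two, Matrix.cons_val_zero, Matrix.cons_val_one]
  have hm : MeasurableSet (Set.pi univ fun i : Fin 2 =>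
        Ico (δ * ((![q.1, q.2] i : ℤ) - 1 / 2)) (δ * ((![q.1, q.2] i : ℤ) + 1 / 2))) :=
    MeasurableSet.univ_pi fun i => measurableSet_Ico
  rw [hset]
  refine ⟨(PiLp.volume_preserving_ofLp (Fin 2)).measurable hm, ?_⟩
  rw [(PiLp.volume_preserving_ofLp (Fin 2)).measure_preimage hm.nullMeasurableSet, Real.volume_pi_Ico]
  simp only [Fin.prod_univ_two]
  rw [← ENNReal.ofReal_mul (by nlinarith)]
  congr 1
  ring

lemma grid_cover (E0 : Set (EuclideanSpace ℝ (Fin 2))) (hE0 : IsCompact E0) (hv : volume E0 = 0)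
    {ε : ℝ} (hε : 0 < ε) : ∃ δ > 0, δ ≤ ε ∧ ∃ P : Finset (ℤ × ℤ), P.card * δ ^ 2 ≤ ε ∧
      ∀ p ∈ E0, ∃ q ∈ P, |p 0 - δ * q.1| ≤ δ / 2 ∧ |p 1 - δ * q.2| ≤ δ / 2 := by
  classical
  have hlim := tendsto_measure_cthickening_of_isCompact (μ := (volume : Measure (EuclideanSpace ℝ (Fin 2)))) hE0
  rw [hv] at hlim
  have h1 : ∀ᶠ r in 𝓝 (0:ℝ), volume (cthickening r E0) < ENNReal.ofReal ε :=
    hlim.eventually_lt_const (by simpa using hε)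
  obtain ⟨ρ, hρ, hb⟩ := Metric.eventually_nhds_iff.1 h1
  set δ := min ε (ρ / 4) with hδd
  have hδ : 0 < δ := by positivity
  have hδρ : volume (cthickening (2 * δ) E0) < ENNReal.ofReal ε := by
    apply hb
    rw [Real.dist_eq, sub_zero, abs_of_pos (by positivity)]
    have := min_le_right ε (ρ / 4)
    linarith
  set Q : EuclideanSpace ℝ (Fin 2) → ℤ × ℤ := fun x => (round (x 0 / δ), round (x 1 / δ)) with hQ
  have hQd : ∀ (x : EuclideanSpace ℝ (Fin 2)), |x 0 - δ * (Q x).1| ≤ δ / 2 ∧ |x 1 - δ * (Q x).2| ≤ δ / 2 := by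
    have : ∀ y : ℝ, |y - δ * round (y / δ)| ≤ δ / 2 := by
      intro y
      have h := abs_sub_round (y / δ)
      have : y - δ * round (y / δ) = δ * (y / δ - round (y / δ)) := by field_simp
      rw [this, abs_mul, abs_of_pos hδ]
      nlinarith
    exact fun x => ⟨this _, this _⟩
  have hfin : (Q '' E0).Finite := by
    obtain ⟨R, hR⟩ := hE0.isBounded.exists_norm_le
    set M : ℤ := ⌈R / δ⌉ + 1 with hM
    have hc : ∀ y : ℝ, |y| ≤ R → round (y / δ) ∈ Icc (-M) M := by
      intro y hy
      have h := abs_le.1 (abs_sub_round (y / δ))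
      have h1 : |y / δ| ≤ R / δ := by
        rw [abs_div, abs_of_pos hδ]; gcongr
      have h1 := abs_le.1 h1
      have h2 := Int.le_ceil (R / δ)
      have e1 : (round (y / δ) : ℝ) ≤ M := by rw [hM]; push_cast; linarith [h.1, h1.2]
      have e2 : ((-M : ℤ) : ℝ) ≤ (round (y / δ) : ℝ) := by rw [hM]; push_cast; linarith [h.2, h1.1]
      exact ⟨by exact_mod_cast e2, by exact_mod_cast e1⟩
    refine ((Set.finite_Icc (-M) M).prod (Set.finite_Icc (-M) M)).subset ?_
    rintro _ ⟨p, hp, rfl⟩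
    exact ⟨hc _ ((PiLp.norm_apply_le p 0).trans (hR p hp)), hc _ ((PiLp.norm_apply_le p 1).trans (hR p hp))⟩
  refine ⟨δ, hδ, min_le_left _ _, hfin.toFinset, ?_, ?_⟩
  · have hsub : (⋃ q ∈ hfin.toFinset, {x | Q x = q}) ⊆ cthickening (2 * δ) E0 := by
      intro x hx
      simp only [mem_iUnion, Set.Finite.mem_toFinset] at hx
      obtain ⟨q, ⟨p, hp, hpq⟩, hxq⟩ := hx
      have hxq : Q x = q := hxq
      refine mem_cthickening_of_dist_le x p _ _ hp ?_
      have hx' := hQd x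
      have hp' := hQd p
      rw [hxq] at hx'
      rw [hpq] at hp'
      have a0 := abs_le.1 hx'.1
      have a1 := abs_le.1 hx'.2
      have b0 := abs_le.1 hp'.1
      have b1 := abs_le.1 hp'.2
      rw [EuclideanSpace.dist_eq, Real.sqrt_le_left (by positivity), Fin.sum_univ_two,
        Real.dist_eq, Real.dist_eq, sq_abs, sq_abs]
      have e0 : (x 0 - p 0) ^ 2 ≤ δ ^ 2 := sq_le_sq' (by linarith [a0.1, b0.2]) (by linarith [a0.2, b0.1])
      have e1 : (x 1 - p 1) ^ 2 ≤ δ ^ 2 := sq_le_sq' (by linarith [a1.1, b1.2]) (by linarith [a1.2, b1.1])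
      nlinarith [sq_nonneg δ]
    have hle := measure_mono (μ := volume) hsub
    have hdis : Set.PairwiseDisjoint (hfin.toFinset : Set (ℤ × ℤ))
        (fun q : ℤ × ℤ => {x : EuclideanSpace ℝ (Fin 2) | Q x = q}) := by
      intro a _ b _ hab
      refine Set.disjoint_left.2 fun x hxa hxb => hab ?_
      have h1 : Q x = a := hxa
      have h2 : Q x = b := hxb
      exact h1.symm.trans h2
    rw [measure_biUnion_finset hdis (fun q _ => (box_volume hδ q).1),
      Finset.sum_congr rfl (fun q _ => (box_volume hδ q).2), Finset.sum_const, nsmul_eq_mul] at hle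
    have := hle.trans hδρ.le
    rw [← ENNReal.ofReal_natCast, ← ENNReal.ofReal_mul (by positivity),
      ENNReal.ofReal_le_ofReal_iff hε.le] at this
    exact this
  · intro p hp
    exact ⟨Q p, by simpa using ⟨p, hp, rfl⟩, hQd p⟩

noncomputable def reflE : EuclideanSpace ℝ (Fin 2) ≃ₗᵢ[ℝ] EuclideanSpace ℝ (Fin 2) :=
  LinearIsometryEquiv.piLpCongrRight 2 (fun i : Fin 2 => if i = 0 then LinearIsometryEquiv.refl ℝ ℝ else LinearIsometryEquiv.neg ℝ)

lemma reflE_zero (p : EuclideanSpace ℝ (Fin 2)) : reflE p 0 = p 0 := by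
  simp [reflE]

lemma reflE_one (p : EuclideanSpace ℝ (Fin 2)) : reflE p 1 = - p 1 := by
  simp [reflE]

lemma reflE_reflE (p : EuclideanSpace ℝ (Fin 2)) : reflE (reflE p) = p := by
  ext i
  fin_cases i
  · simp [reflE_zero]
  · simp [reflE_one]

lemma anti_fun {δ : ℝ} (hδ : 0 < δ) (P : Finset (ℤ × ℤ)) {k : ℝ}
    (hk : ∀ C ⊆ P, IsRv C → (C.card : ℝ) ≤ k) :
    ∃ h : EuclideanSpace ℝ (Fin 2) → ℝ, ContDiff ℝ 1 h ∧ (∀ p, |h p| ≤ 2 * δ * k) ∧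
      (∀ p, ‖fderiv ℝ h p‖ ≤ 5) ∧ (∀ p, 0 ≤ fderiv ℝ h p (reflE diagE)) ∧
      ∀ q ∈ P, ∀ p : EuclideanSpace ℝ (Fin 2), |p 0 - δ * q.1| ≤ δ / 2 → |p 1 - δ * q.2| ≤ δ / 2 →
        1 ≤ fderiv ℝ h p (reflE diagE) := by
  classical
  set σ : ℤ × ℤ → ℤ × ℤ := fun q => (q.1, -q.2) with hσ
  have hσσ : ∀ q, σ (σ q) = q := fun q => by simp [hσ]
  have hσi : Function.Injective σ := fun a b h => by rw [← hσσ a, h, hσσ]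
  obtain ⟨h, hc, hb, hL, h0, h1⟩ := chain_fun hδ (P.image σ) (k := k) (by
    intro C hC hch
    rw [← Finset.card_image_of_injective C hσi]
    refine hk _ ?_ ?_
    · intro x hx
      obtain ⟨y, hy, rfl⟩ := Finset.mem_image.1 hx
      obtain ⟨z, hz, rfl⟩ := Finset.mem_image.1 (hC hy)
      rw [hσσ]; exact hz
    · intro a ha b hb hab
      obtain ⟨a, ha1, rfl⟩ := Finset.mem_image.1 ha
      obtain ⟨b, hb1, rfl⟩ := Finset.mem_image.1 hb
      have := hch a ha1 b hb1 (fun h => hab (by rw [h]))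
      simp only [hσ]
      omega)
  have hd : Differentiable ℝ h := hc.differentiable one_ne_zero
  have hF : ∀ p, HasFDerivAt (fun p => h (reflE p))
      ((fderiv ℝ h (reflE p)).comp (reflE.toContinuousLinearEquiv : EuclideanSpace ℝ (Fin 2) →L[ℝ] EuclideanSpace ℝ (Fin 2))) p := by
    intro p
    exact (hd (reflE p)).hasFDerivAt.comp p reflE.toContinuousLinearEquiv.hasFDerivAt
  refine ⟨fun p => h (reflE p), hc.comp reflE.contDiff, fun p => hb _, ?_, ?_, ?_⟩
  · intro p
    rw [(hF p).fderiv]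
    refine ContinuousLinearMap.opNorm_le_bound _ (by norm_num) fun x => ?_
    refine ((fderiv ℝ h (reflE p)).le_opNorm (reflE x)).trans ?_
    rw [reflE.norm_map]
    gcongr
    exact hL _
  · intro p
    rw [(hF p).fderiv]
    have := h0 (reflE p)
    simpa [reflE_reflE] using this
  · intro q hq p hp0 hp1
    rw [(hF p).fderiv]
    have := h1 (σ q) (Finset.mem_image_of_mem _ hq) (reflE p) (by rw [reflE_zero]; exact hp0)
      (by
        rw [reflE_one]
        simp only [hσ]
        push_cast
        rw [← abs_neg]
        convert hp1 using 2
        ring)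
    simpa [reflE_reflE] using this

lemma two_fun (E0 : Set (EuclideanSpace ℝ (Fin 2))) (hE0 : IsCompact E0) (hv : volume E0 = 0)
    {ε : ℝ} (hε : 0 < ε) : ∃ g₁ g₂ : EuclideanSpace ℝ (Fin 2) → ℝ,
      (ContDiff ℝ 1 g₁ ∧ (∀ p, |g₁ p| ≤ ε) ∧ (∀ p, ‖fderiv ℝ g₁ p‖ ≤ 5) ∧ (∀ p, 0 ≤ fderiv ℝ g₁ p diagE)) ∧
      (ContDiff ℝ 1 g₂ ∧ (∀ p, |g₂ p| ≤ ε) ∧ (∀ p, ‖fderiv ℝ g₂ p‖ ≤ 5) ∧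
        (∀ p, 0 ≤ fderiv ℝ g₂ p (reflE diagE))) ∧
      ∀ p ∈ E0, 1 ≤ fderiv ℝ g₁ p diagE ∨ 1 ≤ fderiv ℝ g₂ p (reflE diagE) := by
  classical
  obtain ⟨δ, hδ, hδε, P, hP, hcov⟩ := grid_cover E0 hE0 hv (ε := min (ε / 4) (ε ^ 2 / 8)) (by positivity)
  have hδ4 := hδε.trans (min_le_left _ _)
  have hP8 := hP.trans (min_le_right _ _)
  set k : ℕ := ⌈ε / 4 / δ⌉₊ with hk
  have hk1 : ε / 4 / δ ≤ k := Nat.le_ceil _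
  have hk2 : (k : ℝ) < ε / 4 / δ + 1 := Nat.ceil_lt_add_one (by positivity)
  have hk0 : (0:ℝ) < k := lt_of_lt_of_le (by positivity) hk1
  obtain ⟨A, B, hAB, hB, hA⟩ := chain_split k P.card P le_rfl
  obtain ⟨g₁, c1, b1, l1, n1, o1⟩ := chain_fun hδ B (k := k) (fun C hC hh => by exact_mod_cast hB C hC hh)
  obtain ⟨g₂, c2, b2, l2, n2, o2⟩ := anti_fun hδ A (k := P.card / k) (fun C hC hh => by
    rw [le_div_iff₀ hk0]; exact_mod_cast hA C hC hh)
  refine ⟨g₁, g₂, ⟨c1, fun p => (b1 p).trans ?_, l1, n1⟩, ⟨c2, fun p => (b2 p).trans ?_, l2, n2⟩, ?_⟩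
  · have : δ * k ≤ δ * (ε / 4 / δ + 1) := by gcongr
    have e : δ * (ε / 4 / δ + 1) = ε / 4 + δ := by field_simp
    linarith
  · rw [← mul_div_assoc, div_le_iff₀ hk0]
    rw [div_le_iff₀ hδ] at hk1
    have : ε * (ε / 4) ≤ ε * (k * δ) := by gcongr
    have : 2 * δ * P.card * δ ≤ ε * k * δ := by nlinarith
    exact le_of_mul_le_mul_right this hδ
  · intro p hp
    obtain ⟨q, hq, hq0, hq1⟩ := hcov p hp
    rw [← hAB] at hq
    rcases Finset.mem_union.1 hq with h | h
    · exact Or.inr (o2 q h p hq0 hq1)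
    · exact Or.inl (o1 q h p hq0 hq1)

lemma flat_two (E0 : Set (EuclideanSpace ℝ (Fin 2))) (hE0 : IsCompact E0) (hv : volume E0 = 0)
    (ν : Measure (EuclideanSpace ℝ (Fin 2))) [IsFiniteMeasure ν] (hν : 0 < ν E0) :
    ∃ e : EuclideanSpace ℝ (Fin 2), ∃ c > (0:ℝ), ∃ L : ℝ, 0 ≤ L ∧ ∀ ε > (0:ℝ),
      ∃ g : EuclideanSpace ℝ (Fin 2) → ℝ, ContDiff ℝ 1 g ∧ (∀ p, |g p| ≤ ε) ∧
        (∀ p, ‖fderiv ℝ g p‖ ≤ L) ∧ c ≤ ∫ p, fderiv ℝ g p e ∂ν := by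
  have hνr : 0 < ν.real E0 := ENNReal.toReal_pos hν.ne' (measure_ne_top _ _)
  have hint : ∀ (g : EuclideanSpace ℝ (Fin 2) → ℝ) (e : EuclideanSpace ℝ (Fin 2)), ContDiff ℝ 1 g →
      (∀ p, ‖fderiv ℝ g p‖ ≤ 5) → (∀ p, 0 ≤ fderiv ℝ g p e) →
      ν.real {p | 1 ≤ fderiv ℝ g p e} ≤ ∫ p, fderiv ℝ g p e ∂ν := by
    intro g e hc hL h0
    have hcont : Continuous fun p => fderiv ℝ g p e :=
      (hc.continuous_fderiv one_ne_zero).clm_apply continuous_const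
    have hi : Integrable (fun p => fderiv ℝ g p e) ν := by
      refine Integrable.of_bound (C := 5 * ‖e‖) hcont.aestronglyMeasurable (ae_of_all _ fun p => ?_)
      refine ((fderiv ℝ g p).le_opNorm e).trans ?_
      gcongr
      exact hL p
    have := mul_meas_ge_le_integral_of_nonneg (ae_of_all _ h0) hi 1
    rwa [one_mul] at this
  have hhalf : ∀ ε > (0:ℝ), ∃ g₁ g₂ : EuclideanSpace ℝ (Fin 2) → ℝ,
      (ContDiff ℝ 1 g₁ ∧ (∀ p, |g₁ p| ≤ ε) ∧ (∀ p, ‖fderiv ℝ g₁ p‖ ≤ 5)) ∧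
      (ContDiff ℝ 1 g₂ ∧ (∀ p, |g₂ p| ≤ ε) ∧ (∀ p, ‖fderiv ℝ g₂ p‖ ≤ 5)) ∧
      (ν.real E0 / 2 ≤ ∫ p, fderiv ℝ g₁ p diagE ∂ν ∨ ν.real E0 / 2 ≤ ∫ p, fderiv ℝ g₂ p (reflE diagE) ∂ν) := by
    intro ε hε
    obtain ⟨g₁, g₂, ⟨c1, b1, l1, n1⟩, ⟨c2, b2, l2, n2⟩, h⟩ := two_fun E0 hE0 hv hε
    refine ⟨g₁, g₂, ⟨c1, b1, l1⟩, ⟨c2, b2, l2⟩, ?_⟩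
    have h1 := hint g₁ diagE c1 l1 n1
    have h2 := hint g₂ (reflE diagE) c2 l2 n2
    have h3 : ν.real E0 ≤ ν.real {p | 1 ≤ fderiv ℝ g₁ p diagE} + ν.real {p | 1 ≤ fderiv ℝ g₂ p (reflE diagE)} :=
      (measureReal_mono h).trans (measureReal_union_le _ _)
    by_contra! hcon
    linarith [hcon.1, hcon.2]
  by_cases H : ∀ ε > (0:ℝ), ∃ g : EuclideanSpace ℝ (Fin 2) → ℝ, ContDiff ℝ 1 g ∧ (∀ p, |g p| ≤ ε) ∧
        (∀ p, ‖fderiv ℝ g p‖ ≤ 5) ∧ ν.real E0 / 2 ≤ ∫ p, fderiv ℝ g p diagE ∂ν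
  · exact ⟨diagE, _, half_pos hνr, 5, by norm_num, H⟩
  · push Not at H
    obtain ⟨ε₁, hε₁, H⟩ := H
    refine ⟨reflE diagE, _, half_pos hνr, 5, by norm_num, fun ε hε => ?_⟩
    obtain ⟨g₁, g₂, ⟨c1, b1, l1⟩, ⟨c2, b2, l2⟩, h⟩ := hhalf (min ε ε₁) (lt_min hε hε₁)
    refine ⟨g₂, c2, fun p => (b2 p).trans (min_le_left _ _), l2, ?_⟩
    rcases h with h | h
    · exact absurd h (not_le.2 (H g₁ c1 (fun p => (b1 p).trans (min_le_right _ _)) l1))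
    · exact h

lemma unif_const {X E : Type*} [MetricSpace X] [NormedAddCommGroup E] [NormedSpace ℝ E]
    [FiniteDimensional ℝ E] {φ : X → E} {K : ℝ≥0} (hφ : LipschitzWith K φ) (x : X)
    (H : ∀ T : E →L[ℝ] ℝ, T ≠ 0 →
      ¬ Tendsto (fun y => |T (φ y - φ x)| / dist y x) (𝓝[≠] x) (𝓝 0)) :
    ∃ m : ℕ, ∀ T ∈ sphere (0 : E →L[ℝ] ℝ) 1, ∀ j : ℕ, ∃ y, 0 < dist y x ∧
      dist y x < 1 / ((j : ℝ) + 1) ∧ 1 / ((m : ℝ) + 1) * dist y x < |T (φ y - φ x)| := by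
  by_contra! hcon
  choose T hT j hj using hcon
  have : ProperSpace (E →L[ℝ] ℝ) := FiniteDimensional.proper ℝ _
  obtain ⟨T0, hT0, s, hs, hlim⟩ := (isCompact_sphere (0 : E →L[ℝ] ℝ) 1).tendsto_subseq hT
  refine H T0 ?_ ?_
  · rintro rfl
    simp at hT0
  · have hl2 : Tendsto (fun i => 1 / ((s i : ℝ) + 1) + K * ‖T0 - T (s i)‖) atTop (𝓝 0) := by
      have h1 : Tendsto (fun i => 1 / ((s i : ℝ) + 1)) atTop (𝓝 0) :=
        tendsto_one_div_add_atTop_nhds_zero_nat.comp hs.tendsto_atTop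
      have h2 : Tendsto (fun i => ‖T0 - T (s i)‖) atTop (𝓝 0) := by
        have := (tendsto_const_nhds (x := T0)).sub hlim
        simpa using this.norm
      have := h1.add (h2.const_mul (K : ℝ))
      simpa using this
    rw [Metric.tendsto_nhds]
    intro ε hε
    obtain ⟨i, hi⟩ := (hl2.eventually_lt_const hε).exists
    have hb : ball x (1 / ((j (s i) : ℝ) + 1)) ∈ 𝓝 x := ball_mem_nhds _ (by positivity)
    filter_upwards [self_mem_nhdsWithin, nhdsWithin_le_nhds hb] with y hy hyb
    have hd : 0 < dist y x := dist_pos.2 hy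
    have h1 := hj (s i) y hd hyb
    have h2 : |T0 (φ y - φ x)| ≤ (1 / ((s i : ℝ) + 1) + K * ‖T0 - T (s i)‖) * dist y x := by
      have e : T0 (φ y - φ x) = T (s i) (φ y - φ x) + (T0 - T (s i)) (φ y - φ x) := by simp
      rw [e]
      refine (abs_add_le _ _).trans ?_
      have h3 : |(T0 - T (s i)) (φ y - φ x)| ≤ ‖T0 - T (s i)‖ * (K * dist y x) := by
        refine ((T0 - T (s i)).le_opNorm _).trans ?_
        gcongr
        rw [← dist_eq_norm]
        exact hφ.dist_le_mul y x
      linarith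
    rw [Real.dist_eq, sub_zero, abs_of_nonneg (by positivity), div_lt_iff₀ hd]
    exact h2.trans_lt (by gcongr)

lemma unif_measurable {X E : Type*} [MetricSpace X] [MeasurableSpace X] [BorelSpace X]
    [NormedAddCommGroup E] [NormedSpace ℝ E]
    [FiniteDimensional ℝ E] {φ : X → E} (hφ : Continuous φ) (c : ℝ) :
    MeasurableSet {x : X | ∀ T ∈ sphere (0 : E →L[ℝ] ℝ) 1, ∀ j : ℕ, ∃ y, 0 < dist y x ∧
      dist y x < 1 / ((j : ℝ) + 1) ∧ c * dist y x < |T (φ y - φ x)|} := by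
  have : ProperSpace (E →L[ℝ] ℝ) := FiniteDimensional.proper ℝ _
  have hset : {x : X | ∀ T ∈ sphere (0 : E →L[ℝ] ℝ) 1, ∀ j : ℕ, ∃ y, 0 < dist y x ∧
      dist y x < 1 / ((j : ℝ) + 1) ∧ c * dist y x < |T (φ y - φ x)|} =
      ⋂ j : ℕ, {x : X | ∀ T ∈ sphere (0 : E →L[ℝ] ℝ) 1, ∃ y, 0 < dist y x ∧
      dist y x < 1 / ((j : ℝ) + 1) ∧ c * dist y x < |T (φ y - φ x)|} := by
    ext x
    simp only [mem_ofPred_eq, mem_iInter]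
    exact ⟨fun h j T hT => h T hT j, fun h T hT j => h j T hT⟩
  rw [hset]
  refine MeasurableSet.iInter fun j => IsOpen.measurableSet ?_
  rw [isOpen_iff_mem_nhds]
  intro x hx
  refine IsCompact.eventually_forall_of_forall_eventually (isCompact_sphere (0 : E →L[ℝ] ℝ) 1) ?_
  intro T hT
  obtain ⟨y, hy1, hy2, hy3⟩ := hx T hT
  have c1 : ContinuousAt (fun z : X × (E →L[ℝ] ℝ) => dist y z.1) (x, T) := by fun_prop
  have c2 : ContinuousAt (fun z : X × (E →L[ℝ] ℝ) => c * dist y z.1) (x, T) := by fun_prop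
  have c3 : ContinuousAt (fun z : X × (E →L[ℝ] ℝ) => |z.2 (φ y - φ z.1)|) (x, T) := by fun_prop
  filter_upwards [c1.eventually_const_lt hy1, c1.eventually_lt_const hy2, c2.eventually_lt c3 hy3]
    with z h1 h2 h3
  exact ⟨y, h1, h2, h3⟩

lemma euclDot_eq {n : ℕ} (D v : EuclideanSpace ℝ (Fin n)) : euclDot D v = innerSL ℝ D v := by
  simp [euclDot, PiLp.inner_apply, mul_comm]

/-- **Chart images have positive Lebesgue measure (n = 1, 2).**  Let `(U,φ)` be an
`n`-dimensional chart in a Lipschitz differentiability space `(X,d,μ)` with `n = 1` or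
`n = 2`.  Then the pushforward `φ_*(μ ⌞ U)` is absolutely continuous with respect to the
`n`-dimensional Lebesgue measure; in particular if `μ(U) > 0` then `φ(U)` has positive
Lebesgue measure. -/
theorem chart_pushforward_ac
    {X : Type*} [MetricSpace X] [CompleteSpace X] [TopologicalSpace.SeparableSpace X]
    [MeasurableSpace X] [BorelSpace X] (μ : Measure X) [IsFiniteMeasure μ]
    (hiso : μ {x : X | 𝓝[≠] x = ⊥} = 0)
    (hX : IsLDS X μ) {n : ℕ} (hn : n = 1 ∨ n = 2)
    (U : Set X) (φ : X → EuclideanSpace ℝ (Fin n))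
    (hU : MeasurableSet U) (hφ : ∃ K : ℝ≥0, LipschitzWith K φ)
    (hchart : ∀ f : X → ℝ, (∃ K : ℝ≥0, LipschitzWith K f) →
      ∀ᵐ x ∂(μ.restrict U), ∃! D, DiffAt f φ x D) :
    ((μ.restrict U).map φ ≪ (volume : Measure (EuclideanSpace ℝ (Fin n)))) ∧
    (0 < μ U → 0 < volume (φ '' U)) := by
  obtain ⟨K, hK⟩ := hφ
  have hφm : Measurable φ := hK.continuous.measurable
  have hac : (μ.restrict U).map φ ≪ (volume : Measure (EuclideanSpace ℝ (Fin n))) := by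
    have flat : ∀ (E0 : Set (EuclideanSpace ℝ (Fin n))) (_ : IsCompact E0) (_ : volume E0 = 0)
        (ν : Measure (EuclideanSpace ℝ (Fin n))) [IsFiniteMeasure ν] (_ : 0 < ν E0),
        ∃ e : EuclideanSpace ℝ (Fin n), ∃ c > (0:ℝ), ∃ L : ℝ, 0 ≤ L ∧ ∀ ε > (0:ℝ),
          ∃ g : EuclideanSpace ℝ (Fin n) → ℝ, ContDiff ℝ 1 g ∧ (∀ p, |g p| ≤ ε) ∧
            (∀ p, ‖fderiv ℝ g p‖ ≤ L) ∧ c ≤ ∫ p, fderiv ℝ g p e ∂ν := by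
      rcases hn with rfl | rfl
      · exact flat_one
      · exact flat_two
    have hne : Nonempty (Fin n) := ⟨⟨0, by omega⟩⟩
    refine Measure.AbsolutelyContinuous.mk fun N hNm hN0 => ?_
    rw [Measure.map_apply hφm hNm, Measure.restrict_apply (hφm hNm)]
    by_contra hpos
    set Sm : ℕ → Set X := fun m => {x : X | ∀ T ∈ sphere (0 : EuclideanSpace ℝ (Fin n) →L[ℝ] ℝ) 1,
      ∀ j : ℕ, ∃ y, 0 < dist y x ∧
      dist y x < 1 / ((j : ℝ) + 1) ∧ 1 / ((m : ℝ) + 1) * dist y x < |T (φ y - φ x)|} with hSm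
    have hSmeas : ∀ m, MeasurableSet (Sm m) := fun m => unif_measurable hK.continuous _
    -- almost every point lies in some `Sm m`
    have hae : ∀ᵐ x ∂(μ.restrict U), ∃ m, x ∈ Sm m := by
      filter_upwards [hchart (fun _ => 0) ⟨0, LipschitzWith.const _⟩] with x hx
      refine unif_const hK x fun T hT hlim => hT ?_
      have h0 : DiffAt (fun _ : X => (0:ℝ)) φ x 0 := by
        unfold DiffAt
        simp only [euclDot, PiLp.zero_apply, zero_mul, Finset.sum_const_zero, sub_zero, abs_zero, zero_div]
        exact tendsto_const_nhds
      have h1 : DiffAt (fun _ : X => (0:ℝ)) φ x ((InnerProductSpace.toDual ℝ _).symm T) := by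
        unfold DiffAt
        refine hlim.congr fun y => ?_
        rw [euclDot_eq]
        simp [abs_sub_comm]
      have := hx.unique h1 h0
      simpa using this
    have hexm : ∃ m, 0 < μ ((φ ⁻¹' N ∩ U) ∩ Sm m) := by
      by_contra! hcon
      apply hpos
      have h1 : μ (⋃ m, (φ ⁻¹' N ∩ U) ∩ Sm m) = 0 :=
        measure_iUnion_null fun m => nonpos_iff_eq_zero.1 (hcon m)
      rw [ae_restrict_iff' hU] at hae
      refine measure_mono_null (t := (⋃ m, (φ ⁻¹' N ∩ U) ∩ Sm m) ∪ {x | ¬ (x ∈ U → ∃ m, x ∈ Sm m)}) ?_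
        (measure_union_null h1 hae)
      intro x hx
      by_cases h : ∃ m, x ∈ Sm m
      · obtain ⟨m, hm⟩ := h
        exact Or.inl (mem_iUnion.2 ⟨m, hx, hm⟩)
      · exact Or.inr fun hh => h (hh hx.2)
    obtain ⟨m, hm⟩ := hexm
    have hinner : ∀ A : Set X, MeasurableSet A → 0 < μ A → ∃ S ⊆ A, IsCompact S ∧ 0 < μ S := by
      intro A hA h
      exact hA.exists_lt_isCompact h
    obtain ⟨S1, hS1, hS1c, hS1p⟩ := hinner _ (((hφm hNm).inter hU).inter (hSmeas m)) hm
    have hE0c : IsCompact (φ '' S1) := hS1c.image hK.continuous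
    have hE0v : volume (φ '' S1) = 0 := by
      refine measure_mono_null ?_ hN0
      rintro _ ⟨x, hx, rfl⟩
      exact (hS1 hx).1.1
    have hνp : 0 < ((μ.restrict S1).map φ) (φ '' S1) := by
      rw [Measure.map_apply hφm hE0c.measurableSet, Measure.restrict_apply (hφm hE0c.measurableSet),
        inter_eq_self_of_subset_right (subset_preimage_image φ S1)]
      exact hS1p
    obtain ⟨e, c, hc, L, hL, hflat⟩ := flat _ hE0c hE0v ((μ.restrict S1).map φ) hνp
    obtain ⟨G, W, hW, hWp, c', hc', hG1, hG2, hG3, hG4, hG5⟩ :=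
      select_seq ((μ.restrict S1).map φ) e hc hL hflat
    rw [Measure.map_apply hφm hW, Measure.restrict_apply (hφm hW)] at hWp
    obtain ⟨S2, hS2, hS2c, hS2p⟩ := hinner _ ((hφm hW).inter hS1c.measurableSet) hWp
    have hφW : ∀ p ∈ φ '' S2, p ∈ W := by
      rintro _ ⟨x, hx, rfl⟩
      exact (hS2 hx).1
    obtain ⟨T1, hT1⟩ : ∃ T : EuclideanSpace ℝ (Fin n) →L[ℝ] ℝ, ‖T‖ = 1 := by
      obtain ⟨v, hv⟩ := exists_norm_eq (EuclideanSpace ℝ (Fin n)) zero_le_one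
      exact ⟨innerSL ℝ v, by rw [innerSL_apply_norm, hv]⟩
    obtain ⟨F, hF, hnd⟩ := nondiff_exists hK hS2c (c := 1 / ((m : ℝ) + 1)) (by positivity)
      (by
        intro x hx D r hr
        have hxm : x ∈ Sm m := (hS1 (hS2 hx).2).2
        obtain ⟨j, hj⟩ := exists_nat_one_div_lt hr
        by_cases hD : D = 0
        · obtain ⟨y, hy1, hy2, hy3⟩ := hxm T1 (by simp [hT1]) j
          exact ⟨y, hy1, hy2.trans hj, by simp [hD]⟩
        · have hDn : 0 < ‖D‖ := norm_pos_iff.2 hD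
          obtain ⟨y, hy1, hy2, hy3⟩ := hxm (‖D‖⁻¹ • D) (by
            rw [mem_sphere_zero_iff_norm, norm_smul, norm_inv, norm_norm, inv_mul_cancel₀ hDn.ne']) j
          refine ⟨y, hy1, hy2.trans hj, ?_⟩
          rw [ContinuousLinearMap.smul_apply, smul_eq_mul, abs_mul, abs_of_pos (inv_pos.2 hDn),
            inv_mul_eq_div, lt_div_iff₀ hDn] at hy3
          linarith)
      G hL hc' hG1 hG2 hG3 (fun k p hp => hG4 k p (hφW p hp))
      (fun ε hε => by
        obtain ⟨N', hN'⟩ := hG5 ε hε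
        exact ⟨N', fun k hk l hl p hp => hN' k hk l hl p (hφW p hp)⟩)
    have hFd := hchart F hF
    rw [ae_restrict_iff' hU] at hFd
    refine hS2p.ne' (measure_mono_null ?_ hFd)
    intro x hx hcon
    obtain ⟨D, hD, -⟩ := hcon (hS1 (hS2 hx).2).1.2
    refine hnd x hx (innerSL ℝ D) ?_
    unfold DiffAt at hD
    simp_rw [euclDot_eq] at hD
    exact hD
  refine ⟨hac, fun hUp => ?_⟩
  by_contra hv
  have hv0 : volume (φ '' U) = 0 := nonpos_iff_eq_zero.1 (not_lt.1 hv)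
  have h1 := hac ((measure_toMeasurable (φ '' U)).trans hv0)
  rw [Measure.map_apply hφm (measurableSet_toMeasurable _ _),
    Measure.restrict_apply (hφm (measurableSet_toMeasurable _ _)),
    inter_eq_self_of_subset_right
      ((subset_preimage_image φ U).trans (preimage_mono (subset_toMeasurable _ _)))] at h1
  exact hUp.ne' h1
end

section
/- Every Lipschitz differentiability space (X,d,μ) is pointwise doubling, i.e. limsup_{r→0} μ(B(x,r))/μ(B(x,r/2)) < ∞ for μ-almost every x ∈ X. -/
open MeasureTheory Metric Filter Set Topology
open scoped ENNReal NNReal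

lemma diff_contra {X : Type*} [MetricSpace X] {n : ℕ} (φ : X → EuclideanSpace ℝ (Fin n)) (x : X)
    (f : ℕ → X → ℝ) (hf0 : ∀ l, f l x = 0) (hd : ∀ l, ∃ D, DiffAt (f l) φ x D)
    (η : ℝ) (hη : 0 < η)
    (hk : ∀ c, ∀ ε > 0, ∃ y, dist y x < ε ∧ y ≠ x ∧ η * dist y x ≤ f c y ∧
      ∀ l, l ≠ c → f l y = 0) : False := by
  choose D hD using hd
  have hni : ¬ LinearIndependent ℝ D := fun h =>
    not_finite_iff_infinite.2 (inferInstance : Infinite ℕ) h.finite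
  obtain ⟨s, g, hsum, c, hcs, hgc⟩ := not_linearIndependent_iff.1 hni
  have h1 : ∀ l, Tendsto (fun y => (f l y - f l x - euclDot (D l) (φ y - φ x)) / dist y x)
      (𝓝[≠] x) (𝓝 0) := by
    intro l
    rw [tendsto_zero_iff_abs_tendsto_zero]
    refine (hD l).congr fun y => ?_
    simp [abs_div, abs_of_nonneg dist_nonneg]
  have h2 : Tendsto (fun y => ∑ l ∈ s, g l *
      ((f l y - f l x - euclDot (D l) (φ y - φ x)) / dist y x)) (𝓝[≠] x) (𝓝 0) := by
    have := tendsto_finsetSum s (fun l _ => (h1 l).const_mul (g l))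
    simpa using this
  have h0 : ∀ w : EuclideanSpace ℝ (Fin n), ∑ l ∈ s, g l * euclDot (D l) w = 0 := by
    intro w
    have hco : ∀ i, ∑ l ∈ s, g l * D l i = 0 := by
      intro i
      have := congrArg (fun v : EuclideanSpace ℝ (Fin n) => v i) hsum
      simpa using this
    simp only [euclDot, Finset.mul_sum]
    rw [Finset.sum_comm]
    refine Finset.sum_eq_zero fun i _ => ?_
    have : ∑ l ∈ s, g l * (D l i * w i) = (∑ l ∈ s, g l * D l i) * w i := by
      rw [Finset.sum_mul]; exact Finset.sum_congr rfl fun l _ => by ring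
    rw [this, hco, zero_mul]
  have h3 : ∀ y, ∑ l ∈ s, g l * ((f l y - f l x - euclDot (D l) (φ y - φ x)) / dist y x)
      = (∑ l ∈ s, g l * f l y) / dist y x := by
    intro y
    have : ∀ l, g l * ((f l y - f l x - euclDot (D l) (φ y - φ x)) / dist y x) =
        (g l * f l y) / dist y x - (g l * euclDot (D l) (φ y - φ x)) / dist y x := by
      intro l; rw [hf0]; ring
    simp_rw [this]
    rw [Finset.sum_sub_distrib, ← Finset.sum_div, ← Finset.sum_div, h0]
    simp
  simp_rw [h3] at h2
  have hpos : 0 < |g c| * η := mul_pos (abs_pos.2 hgc) hη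
  have h4 := (Metric.tendsto_nhdsWithin_nhds.1 h2) _ hpos
  obtain ⟨δ, hδ, h5⟩ := h4
  obtain ⟨y, hy1, hy2, hy3, hy4⟩ := hk c δ hδ
  have h6 := h5 hy2 hy1
  have h7 : ∑ l ∈ s, g l * f l y = g c * f c y :=
    Finset.sum_eq_single_of_mem c hcs fun l _ hl => by rw [hy4 l hl, mul_zero]
  have hdp : 0 < dist y x := dist_pos.2 hy2
  rw [h7, Real.dist_eq, sub_zero, abs_div, abs_mul, abs_of_pos hdp, div_lt_iff₀ hdp] at h6
  have h8 : |g c| * (η * dist y x) ≤ |g c| * |f c y| :=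
    mul_le_mul_of_nonneg_left (hy3.trans (le_abs_self _)) (abs_nonneg _)
  linarith

/-- Scale functions: given well separated intervals, 1-Lipschitz functions on `ℝ` for every class. -/
lemma exists_scale_functions (a b : ℕ → ℝ) (ha : ∀ j, 0 < a j) (hab : ∀ j, a j < b j)
    (hb : ∀ j, b (j + 1) = a j / 4) :
    ∃ τ : ℕ → ℝ → ℝ, (∀ c, LipschitzWith 1 (τ c)) ∧ (∀ c, τ c 0 = 0) ∧
      ∀ j t, a j < t → t < b j → (t / 2 ≤ τ (Nat.unpair j).1 t ∧
        ∀ l, l ≠ (Nat.unpair j).1 → τ l t = 0) := by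
  have hanti : Antitone b := antitone_nat_of_succ_le fun j => by
    have := ha j; have := hab j; rw [hb]; linarith
  let W : ℕ → Set ℝ := fun c => {t | ∀ j, (Nat.unpair j).1 = c → t ∉ Ioo (a j / 2) (2 * b j)}
  have h0 : ∀ c, (0 : ℝ) ∈ W c := fun c j _ h => by
    have := ha j; have := h.1; linarith
  refine ⟨fun c t => infDist t (W c), fun c => lipschitz_infDist_pt _,
    fun c => infDist_zero_of_mem (h0 c), fun j t h1 h2 => ⟨?_, fun l hl => ?_⟩⟩
  · refine (le_infDist ⟨0, h0 _⟩).2 fun s hs => ?_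
    have := hs j rfl
    rw [Real.dist_eq]
    by_cases h : a j / 2 < s
    · have h' : 2 * b j ≤ s := by
        by_contra hh; exact this ⟨h, not_le.1 hh⟩
      rw [abs_sub_comm]
      refine le_trans ?_ (le_abs_self _)
      have := ha j
      linarith
    · refine le_trans ?_ (le_abs_self _)
      linarith
  · refine infDist_zero_of_mem fun i hi hmem => ?_
    rcases lt_trichotomy i j with h | h | h
    · have := hanti (Nat.succ_le_of_lt h)
      rw [Nat.succ_eq_add_one, hb] at this
      have := hmem.1; have := ha i
      linarith
    · subst h; exact hl hi.symm
    · have := hanti (Nat.succ_le_of_lt h)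
      rw [Nat.succ_eq_add_one, hb] at this
      have := hmem.2; have := ha j
      linarith

/-- Porous sets are null in a Lipschitz differentiability space. -/
lemma porous_null {X : Type*} [MetricSpace X] [MeasurableSpace X] [BorelSpace X] (μ : Measure X)
    [IsFiniteMeasure μ] (hX : IsLDS X μ) (S : Set X) (η : ℝ) (hη : 0 < η)
    (hS : ∀ x ∈ S, ∀ ε > 0, ∃ y, dist y x < ε ∧ η * dist y x < infDist y S) : μ S = 0 := by
  obtain ⟨n, U, φ, hUm, hU, -, hdiff⟩ := hX
  rcases S.eq_empty_or_nonempty with rfl | hne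
  · simp
  set ν := μ.restrict S with hν
  let G : ℝ → ℝ → Set X := fun a b =>
    {x | ∃ y, a < infDist y S ∧ infDist y S < b ∧ η * dist y x < infDist y S}
  have hGo : ∀ a b, IsOpen (G a b) := by
    intro a b
    have : G a b = ⋃ y : X, {x | a < infDist y S ∧ infDist y S < b ∧
        η * dist y x < infDist y S} := by
      ext x; simp [G]
    rw [this]
    refine isOpen_iUnion fun y => ?_
    refine isOpen_const.and (isOpen_const.and ?_)
    exact isOpen_lt (by fun_prop) continuous_const
  have hstep : ∀ b > 0, ∀ ε : ℝ≥0∞, 0 < ε → ∃ a, 0 < a ∧ a < b ∧ ν (G a b)ᶜ < ε := by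
    intro b hb ε hε
    let s : ℕ → Set X := fun k => (G (b / (k + 2)) b)ᶜ
    have hanti : Antitone s := by
      intro k l hkl x hx hxG
      obtain ⟨y, h1, h2, h3⟩ := hxG
      refine hx ⟨y, lt_of_le_of_lt ?_ h1, h2, h3⟩
      have : (k : ℝ) ≤ l := by exact_mod_cast hkl
      gcongr
    have ht := tendsto_measure_iInter_atTop (μ := ν) (s := s)
      (fun k => (hGo _ _).measurableSet.compl.nullMeasurableSet) hanti ⟨0, measure_ne_top _ _⟩
    have hz : ν (⋂ k, s k) = 0 := by
      rw [hν, Measure.restrict_apply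
        (MeasurableSet.iInter fun k => (hGo _ _).measurableSet.compl)]
      convert measure_empty (μ := μ)
      ext x
      simp only [mem_inter_iff, mem_iInter, mem_empty_iff_false, iff_false, not_and]
      intro hx hxS
      obtain ⟨y, hy1, hy2⟩ := hS x hxS b hb
      have hpos : 0 < infDist y S := lt_of_le_of_lt (by positivity) hy2
      obtain ⟨k, hk⟩ := exists_nat_gt (b / infDist y S)
      refine hx k ⟨y, ?_, (infDist_le_dist_of_mem hxS).trans_lt hy1, hy2⟩
      rw [div_lt_iff₀ hpos] at hk
      rw [div_lt_iff₀ (by positivity)]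
      nlinarith
    rw [hz] at ht
    obtain ⟨k, hk⟩ := ((tendsto_order.1 ht).2 ε hε).exists
    refine ⟨b / (k + 2), by positivity, ?_, hk⟩
    rw [div_lt_iff₀ (by positivity)]
    have : (0 : ℝ) ≤ k := Nat.cast_nonneg k
    nlinarith
  have hstep' : ∀ (b : {b : ℝ // 0 < b}) (j : ℕ), ∃ a : {a : ℝ // 0 < a},
      a.1 < b.1 ∧ ν (G a.1 b.1)ᶜ < (2⁻¹ : ℝ≥0∞) ^ j := by
    intro b j
    obtain ⟨a, h1, h2, h3⟩ := hstep b.1 b.2 ((2⁻¹ : ℝ≥0∞) ^ j)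
      (ENNReal.pow_pos (by simp) _)
    exact ⟨⟨a, h1⟩, h2, h3⟩
  choose A hA1 hA2 using hstep'
  let B : ℕ → {b : ℝ // 0 < b} := fun j => Nat.rec ⟨1, one_pos⟩
    (fun j b => ⟨(A b j).1 / 4, by have := (A b j).2; positivity⟩) j
  let a : ℕ → ℝ := fun j => (A (B j) j).1
  let b : ℕ → ℝ := fun j => (B j).1
  have ha : ∀ j, 0 < a j := fun j => (A (B j) j).2
  have hab : ∀ j, a j < b j := fun j => hA1 _ _
  have hb : ∀ j, b (j + 1) = a j / 4 := fun j => rfl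
  have hblim : ∀ j, b j ≤ (1 / 4) ^ j := by
    intro j
    induction j with
    | zero => exact le_of_eq (by simp [b, B])
    | succ j ih => rw [hb, pow_succ]; have := hab j; linarith
  have hν2 : ∀ j, ν (G (a j) (b j))ᶜ ≤ (2⁻¹ : ℝ≥0∞) ^ j := fun j => (hA2 _ _).le
  obtain ⟨τ, hτL, hτ0, hτ⟩ := exists_scale_functions a b ha hab hb
  have hBC : ∀ᵐ x ∂ν, ∀ᶠ j in atTop, x ∉ (G (a j) (b j))ᶜ := by
    apply ae_eventually_notMem
    refine ne_top_of_le_ne_top ?_ (ENNReal.tsum_le_tsum hν2)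
    rw [ENNReal.tsum_geometric]
    simp
  have hcl : ∀ᵐ x ∂ν, x ∈ closure S := by
    rw [ae_iff]
    change ν (closure S)ᶜ = 0
    rw [hν, Measure.restrict_apply isClosed_closure.measurableSet.compl]
    convert measure_empty (μ := μ)
    ext x
    simp only [mem_inter_iff, mem_compl_iff, mem_empty_iff_false, iff_false, not_and]
    exact fun h hx => h (subset_closure hx)
  let f : ℕ → X → ℝ := fun l y => τ l (infDist y S)
  have hfL : ∀ l, LipschitzWith 1 (f l) := fun l => by
    have h := (hτL l).comp (lipschitz_infDist_pt S)
    rw [one_mul] at h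
    exact h
  have hD : ∀ᵐ x ∂ν, ∀ l i, x ∈ U i → ∃ D, DiffAt (f l) (φ i) x D := by
    rw [ae_all_iff]; intro l
    rw [ae_all_iff]; intro i
    have h1 := hdiff (f l) ⟨1, hfL l⟩ i
    have h2 : ∀ᵐ x ∂μ, x ∈ U i → ∃! D, DiffAt (f l) (φ i) x D := by
      rwa [ae_restrict_iff' (hUm i)] at h1
    filter_upwards [ae_restrict_of_ae h2] with x hx hxU using (hx hxU).exists
  have hF : ∀ᵐ x ∂ν, False := by
    filter_upwards [hBC, hcl, hD] with x hx1 hx2 hx3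
    obtain ⟨i, hi⟩ := mem_iUnion.1 (hU ▸ mem_univ x)
    have hx0 : infDist x S = 0 := (mem_closure_iff_infDist_zero hne).1 hx2
    refine diff_contra (φ i) x f (fun l => ?_) (fun l => hx3 l i hi) (η / 2) (by positivity) ?_
    · simp only [f, hx0, hτ0]
    · intro c ε hε
      obtain ⟨J, hJ⟩ := eventually_atTop.1 hx1
      obtain ⟨m, hm⟩ := exists_pow_lt_of_lt_one (show 0 < η * ε by positivity)
        (show (1 / 4 : ℝ) < 1 by norm_num)
      set j := Nat.pair c (max J m) with hj
      have hjm : max J m ≤ j := Nat.right_le_pair _ _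
      obtain ⟨y, h1, h2, h3⟩ := not_not.1 (hJ j ((le_max_left _ _).trans hjm))
      have hc : (Nat.unpair j).1 = c := by simp [hj]
      obtain ⟨t1, t2⟩ := hτ j _ h1 h2
      rw [hc] at t1 t2
      have hbj : b j < η * ε := by
        refine ((hblim j).trans ?_).trans_lt hm
        exact pow_le_pow_of_le_one (by norm_num) (by norm_num) ((le_max_right _ _).trans hjm)
      refine ⟨y, ?_, ?_, ?_, t2⟩
      · exact lt_of_mul_lt_mul_left (h3.trans (h2.trans hbj)) hη.le
      · rintro rfl
        rw [hx0] at h1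
        exact absurd h1 (not_lt.2 (ha j).le)
      · change _ ≤ τ c (infDist y S)
        linarith
  have : ν = 0 := by
    rwa [eventually_false_iff_eq_bot, ae_eq_bot] at hF
  exact Measure.restrict_eq_zero.1 this

/-- **Lipschitz differentiability spaces are pointwise doubling**:
`limsup_{r→0} μ(B(x,r))/μ(B(x,r/2)) < ∞` for `μ`-almost every `x ∈ X`. -/
theorem lds_pointwise_doubling
    {X : Type*} [MetricSpace X] [CompleteSpace X] [TopologicalSpace.SeparableSpace X]
    [MeasurableSpace X] [BorelSpace X] (μ : Measure X) [IsFiniteMeasure μ]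
    (hiso : μ {x : X | 𝓝[≠] x = ⊥} = 0)
    (hX : IsLDS X μ) :
    ∀ᵐ x ∂μ, limsup (fun r : ℝ => μ (ball x r) / μ (ball x (r / 2))) (𝓝[>] (0 : ℝ)) < ⊤ := by
  set A : Set X := {x | ¬ limsup (fun r : ℝ => μ (ball x r) / μ (ball x (r / 2)))
    (𝓝[>] (0 : ℝ)) < ⊤} with hA
  change μ A = 0
  have hr : ∀ (k : ℕ) (x : X), ∃ r : ℝ, x ∈ A → 0 < r ∧ r < (1 / 2) ^ k ∧
      (2 : ℝ≥0∞) ^ k * μ (ball x (r / 2)) ≤ μ (ball x r) := by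
    intro k x
    by_cases hx : x ∈ A
    swap
    · exact ⟨0, fun h => absurd h hx⟩
    have htop := top_le_iff.1 (not_lt.1 hx)
    have hf := frequently_lt_of_lt_limsup (b := (2 : ℝ≥0∞) ^ k) (by isBoundedDefault)
      (htop ▸ ENNReal.pow_lt_top (by simp))
    have hI : Ioo (0 : ℝ) ((1 / 2) ^ k) ∈ 𝓝[>] (0 : ℝ) := Ioo_mem_nhdsGT (by positivity)
    obtain ⟨r, h1, h2⟩ := (hf.and_eventually hI).exists
    exact ⟨r, fun _ => ⟨h2.1, h2.2, ENNReal.mul_le_of_le_div h1.le⟩⟩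
  choose r hr using hr
  have hu := fun k => Vitali.exists_disjoint_subfamily_covering_enlargement_ball A (fun x => x)
    (r k) ((1 / 2) ^ k) (fun x hx => (hr k x hx).2.1.le) 4 (by norm_num)
  choose u huA hud huc using hu
  let H : ℕ → Set X := fun k => ⋃ x ∈ u k, ball x (r k x / 2)
  have hcount : ∀ k, (u k).Countable := fun k =>
    (hud k).countable_of_isOpen (fun x _ => isOpen_ball)
      fun x hx => ⟨x, mem_ball_self (hr k x (huA k hx)).1⟩
  have hH : ∀ k, μ (H k) ≤ μ univ * (2⁻¹ : ℝ≥0∞) ^ k := by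
    intro k
    have : Countable (u k) := (hcount k).to_subtype
    have h1 : μ (H k) ≤ ∑' x : u k, μ (ball (x : X) (r k x / 2)) :=
      measure_biUnion_le μ (hcount k) _
    have h2 : ∑' x : u k, μ (ball (x : X) (r k x)) ≤ μ univ :=
      tsum_measure_le_measure_univ (s := fun x : u k => ball (x : X) (r k x)) (fun _ => measurableSet_ball.nullMeasurableSet)
        fun x y hxy => ((hud k) x.2 y.2 (fun h => hxy (Subtype.ext h))).aedisjoint
    have h3 : (2 : ℝ≥0∞) ^ k * ∑' x : u k, μ (ball (x : X) (r k x / 2)) ≤ μ univ := by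
      rw [← ENNReal.tsum_mul_left]
      exact (ENNReal.tsum_le_tsum fun x : u k => (hr k x (huA k x.2)).2.2).trans h2
    refine h1.trans ?_
    rw [← ENNReal.inv_pow, ← div_eq_mul_inv, ENNReal.le_div_iff_mul_le
      (Or.inl (by simp)) (Or.inl (by simp)), mul_comm]
    exact h3
  have hBC : ∀ᵐ x ∂μ, ∀ᶠ k in atTop, x ∉ H k := by
    apply ae_eventually_notMem
    refine ne_top_of_le_ne_top ?_ (ENNReal.tsum_le_tsum hH)
    rw [ENNReal.tsum_mul_left, ENNReal.tsum_geometric]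
    exact ENNReal.mul_ne_top (measure_ne_top _ _) (by simp)
  let S : ℕ → Set X := fun m => {x | x ∈ A ∧ ∀ k, m ≤ k → x ∉ H k}
  have hS : ∀ m, μ (S m) = 0 := by
    intro m
    refine porous_null μ hX (S m) (1 / 16) (by norm_num) fun x hx ε hε => ?_
    obtain ⟨k0, hk0⟩ := exists_pow_lt_of_lt_one (show 0 < ε / 4 by positivity)
        (show (1 / 2 : ℝ) < 1 by norm_num)
    set k := max m k0 with hk
    obtain ⟨y, hy, hsub⟩ := huc k x hx.1
    have hyr := hr k y (huA k hy)
    have hd : dist x y < 4 * r k y := mem_ball.1 (hsub (mem_ball_self (hr k x hx.1).1))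
    have hle : (1 / 2 : ℝ) ^ k ≤ (1 / 2) ^ k0 :=
      pow_le_pow_of_le_one (by norm_num) (by norm_num) (le_max_right _ _)
    rw [dist_comm] at hd
    refine ⟨y, by linarith [hyr.2.1], ?_⟩
    have : r k y / 2 ≤ infDist y (S m) := by
      refine (le_infDist ⟨x, hx⟩).2 fun z hz => ?_
      by_contra hlt
      refine hz.2 k (le_max_left _ _) (mem_iUnion₂.2 ⟨y, hy, ?_⟩)
      rw [mem_ball, dist_comm]
      exact not_le.1 hlt
    linarith [hyr.1]
  have hAE : ∀ᵐ x ∂μ, ∀ m, x ∉ S m := ae_all_iff.2 fun m => measure_eq_zero_iff_ae_notMem.1 (hS m)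
  have : ∀ᵐ x ∂μ, x ∉ A := by
    filter_upwards [hBC, hAE] with x h1 h2 hx
    obtain ⟨m, hm⟩ := eventually_atTop.1 h1
    exact h2 m ⟨hx, hm⟩
  exact measure_eq_zero_iff_ae_notMem.2 this
end

section
/- Let (X,d,μ) be a metric measure space and U ⊂ X Borel. Suppose that for every Lipschitz f: X → ℝ, limsup_{x→x₀} |f(x)−f(x₀)|/d(x,x₀) = 0 for μ-almost every x₀ ∈ U. Then μ(U) = 0. -/
open MeasureTheory Metric Filter Set Topology
open scoped ENNReal NNReal

/-- Countable closed nets. -/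
lemma exists_net {X : Type*} [MetricSpace X] [TopologicalSpace.SeparableSpace X]
    (r : ℝ) (hr : 0 < r) :
    ∃ N : Set X, N.Countable ∧ (∀ x, ∃ y ∈ N, dist x y ≤ r) ∧
      ∀ x, x ∉ N → ∃ c > 0, ∀ y ∈ N, c ≤ dist x y := by
  obtain ⟨N, hN⟩ := zorn_subset {N : Set X | N.Pairwise (fun x y => r ≤ dist x y)} (by
    intro c hc hchain
    refine ⟨⋃₀ c, ?_, fun s hs => subset_sUnion_of_mem hs⟩
    exact (pairwise_sUnion hchain.directedOn).2 (fun s hs => hc hs))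
  have hsep : N.Pairwise (fun x y => r ≤ dist x y) := hN.1
  refine ⟨N, ?_, ?_, ?_⟩
  · refine PairwiseDisjoint.countable_of_isOpen (s := fun x => ball x (r / 2)) ?_
      (fun _ _ => isOpen_ball) (fun x _ => ⟨x, mem_ball_self (by linarith)⟩)
    intro x hx y hy hxy
    exact ball_disjoint_ball (by linarith [hsep hx hy hxy])
  · intro x
    by_contra! hcon
    have hins : insert x N ∈ {N : Set X | N.Pairwise (fun x y => r ≤ dist x y)} := by
      refine hsep.insert ?_
      intro y hy _
      exact ⟨(hcon y hy).le, by rw [dist_comm]; exact (hcon y hy).le⟩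
    have hx : x ∈ N := hN.2 hins (subset_insert _ _) (mem_insert _ _)
    have := hcon x hx
    rw [dist_self] at this
    linarith
  · intro x hx
    by_cases hy : ∃ y ∈ N, dist x y < r / 2
    · obtain ⟨y, hyN, hy⟩ := hy
      refine ⟨dist x y, dist_pos.2 (fun h => hx (h ▸ hyN)), fun z hz => ?_⟩
      by_cases hzy : z = y
      · rw [hzy]
      · have h1 := hsep hz hyN hzy
        have h2 := dist_triangle_left z y x
        linarith
    · push Not at hy
      exact ⟨r / 2, by linarith, hy⟩

/-- Steep points of `f` at scale `1/(n+1)`, with margin `δ`. -/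
def steep {X : Type*} [MetricSpace X] (n : ℕ) (δ : ℝ) (f : X → ℝ) : Set X :=
  {x | ∃ y, 0 < dist x y ∧ dist x y < 1 / ((n : ℝ) + 1) ∧ dist x y / 2 + δ < |f x - f y|}

lemma isOpen_steep {X : Type*} [MetricSpace X] (n : ℕ) (δ : ℝ) (f : X → ℝ)
    (hf : Continuous f) : IsOpen (steep n δ f) := by
  unfold steep
  rw [Set.ofPred_exists]
  refine isOpen_iUnion fun y => ?_
  have h1 : IsOpen {x : X | 0 < dist x y} := isOpen_lt (by fun_prop) (by fun_prop)
  have h2 : IsOpen {x : X | dist x y < 1 / ((n : ℝ) + 1)} :=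
    isOpen_lt (by fun_prop) (by fun_prop)
  have h3 : IsOpen {x : X | dist x y / 2 + δ < |f x - f y|} :=
    isOpen_lt (by fun_prop) (by fun_prop)
  exact h1.inter (h2.inter h3)

/-- Key approximation. -/
lemma approx {X : Type*} [MetricSpace X] [TopologicalSpace.SeparableSpace X] [Nonempty X]
    (f : X → ℝ) (η : ℝ) (hη : 0 < η)
    (hf : ∀ x y, f x - f y ≤ (1 - η) * dist x y) (δ : ℝ) (hδ : 0 < δ) (n : ℕ) :
    ∃ g : X → ℝ, (∀ x y, g x - g y ≤ dist x y) ∧ (∀ x, |g x - f x| ≤ δ) ∧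
      (steep n 0 g)ᶜ.Countable := by
  have hn : (0 : ℝ) < 1 / ((n : ℝ) + 1) := by positivity
  set s := 1 / ((n : ℝ) + 1) with hs
  obtain ⟨r, hr, hr1, hr2⟩ : ∃ r > 0, 2 * r ≤ δ ∧ 3 * r ≤ η * s := by
    refine ⟨min (δ / 2) (η * s / 3), by positivity, ?_, ?_⟩
    · linarith [min_le_left (δ / 2) (η * s / 3)]
    · linarith [min_le_right (δ / 2) (η * s / 3)]
  obtain ⟨N, hNc, hNd, hNcl⟩ := exists_net (X := X) r hr
  have hf1 : ∀ x y, f x - f y ≤ dist x y := fun x y => by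
    nlinarith [hf x y, dist_nonneg (x := x) (y := y)]
  have : Nonempty N := by
    obtain ⟨y, hy, _⟩ := hNd (Classical.arbitrary X)
    exact ⟨⟨y, hy⟩⟩
  set g : X → ℝ := fun x => ⨅ y : N, (f y + dist x y) with hg
  have hlb : ∀ (x : X) (y : N), f x ≤ f y + dist x y := fun x y => by linarith [hf1 x y]
  have hbdd : ∀ x : X, BddBelow (range fun y : N => f y + dist x (y : X)) := fun x =>
    ⟨f x, by rintro _ ⟨y, rfl⟩; exact hlb x y⟩
  have hfg : ∀ x, f x ≤ g x := fun x => le_ciInf (hlb x)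
  have hgle : ∀ (x : X) (y : N), g x ≤ f y + dist x y := fun x y => ciInf_le (hbdd x) y
  have hgf : ∀ x, g x ≤ f x + 2 * r := fun x => by
    obtain ⟨y, hy, hxy⟩ := hNd x
    have h1 := hgle x ⟨y, hy⟩
    have h2 := hf1 y x
    rw [dist_comm] at h2
    simp only at h1
    linarith
  refine ⟨g, ?_, ?_, ?_⟩
  · intro x y
    have : g x - dist x y ≤ g y := le_ciInf fun z => by
      linarith [hgle x z, dist_triangle x y z]
    linarith
  · intro x
    rw [abs_le]
    constructor <;> linarith [hfg x, hgf x]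
  · refine hNc.mono ?_
    intro x hx
    by_contra hxN
    apply hx
    obtain ⟨c, hc, hcN⟩ := hNcl x hxN
    have hlt : g x < g x + min (c / 2) r := by
      have : 0 < min (c / 2) r := by positivity
      linarith
    obtain ⟨y, hy⟩ := exists_lt_of_ciInf_lt (f := fun y : N => f y + dist x y) hlt
    have hcy := hcN y y.2
    have hgy : g y ≤ f y := by simpa using hgle y y
    have hm1 := min_le_left (c / 2) r
    have hm2 := min_le_right (c / 2) r
    refine ⟨y, by linarith, ?_, ?_⟩
    · have h1 := hf x y
      have h2 := hgf x
      have : η * dist x (y : X) < η * s := by nlinarith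
      exact lt_of_mul_lt_mul_left this hη.le
    · refine lt_of_lt_of_le ?_ (le_abs_self _)
      linarith

open BoundedContinuousFunction in
lemma exists_steep {X : Type*} [MetricSpace X] [TopologicalSpace.SeparableSpace X] [Nonempty X]
    [MeasurableSpace X] [BorelSpace X] (ν : Measure X) [IsFiniteMeasure ν] [NullSingletonClass ν] :
    ∃ f : X → ℝ, LipschitzWith 1 f ∧ ∀ n, ν (steep n 0 f)ᶜ = 0 := by
  let L : Set (X →ᵇ ℝ) := {f | ∀ x y, f x - f y ≤ dist x y}
  have hL : IsClosed L := by
    have : L = ⋂ x, ⋂ y, {f : X →ᵇ ℝ | f x - f y ≤ dist x y} := by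
      ext f; simp [L]
    rw [this]
    refine isClosed_iInter fun x => isClosed_iInter fun y => isClosed_le ?_ continuous_const
    exact (continuous_eval_const x).sub (continuous_eval_const y)
  have : CompleteSpace L := hL.completeSpace_coe
  let O : ℕ × ℕ → Set L := fun p =>
    {f | ν (steep p.1 0 (f : X →ᵇ ℝ))ᶜ < ENNReal.ofReal (1 / ((p.2 : ℝ) + 1))}
  have hopen : ∀ p, IsOpen (O p) := by
    rintro ⟨n, m⟩
    rw [Metric.isOpen_iff]
    intro f hf
    let e : ℕ → ℝ := fun k => 1 / ((k : ℝ) + 1)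
    have he : Antitone e := fun a b hab => by
      exact one_div_le_one_div_of_le (by positivity) (by gcongr)
    have hInter : ⋂ k, (steep n (e k) (f : X →ᵇ ℝ))ᶜ = (steep n 0 (f : X →ᵇ ℝ))ᶜ := by
      rw [← compl_iUnion]
      congr 1
      ext x
      rw [mem_iUnion]
      constructor
      · rintro ⟨k, y, h1, h2, h3⟩
        have : 0 < e k := by positivity
        exact ⟨y, h1, h2, by linarith⟩
      · rintro ⟨y, h1, h2, h3⟩
        obtain ⟨k, hk⟩ := exists_nat_one_div_lt (sub_pos.2 h3)
        refine ⟨k, y, h1, h2, ?_⟩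
        simp only [e]
        linarith
    have ht := tendsto_measure_iInter_atTop (μ := ν)
      (s := fun k => (steep n (e k) (f : X →ᵇ ℝ))ᶜ)
      (fun k => (isOpen_steep n (e k) _ (f : X →ᵇ ℝ).continuous).measurableSet.compl.nullMeasurableSet)
      (by
        intro a b hab
        apply compl_subset_compl.2 _
        rintro x ⟨y, h1, h2, h3⟩
        exact ⟨y, h1, h2, by linarith [he hab]⟩)
      ⟨0, measure_ne_top _ _⟩
    rw [hInter] at ht
    obtain ⟨k, hk⟩ := (ht.eventually_lt_const hf).exists
    have hek : 0 < e k := by positivity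
    refine ⟨e k / 2, by positivity, ?_⟩
    intro g hg
    refine lt_of_le_of_lt (measure_mono (compl_subset_compl.2 ?_)) hk
    rintro x ⟨y, h1, h2, h3⟩
    refine ⟨y, h1, h2, ?_⟩
    have hd : dist (g : X →ᵇ ℝ) f < e k / 2 := hg
    have hx := (dist_coe_le_dist (f := (g : X →ᵇ ℝ)) (g := f) x).trans_lt hd
    have hy := (dist_coe_le_dist (f := (g : X →ᵇ ℝ)) (g := f) y).trans_lt hd
    rw [Real.dist_eq, abs_lt] at hx hy
    rcases lt_abs.1 h3 with h3 | h3
    · exact lt_abs.2 (Or.inl (by linarith))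
    · exact lt_abs.2 (Or.inr (by linarith))
  have hdense : ∀ p, Dense (O p) := by
    rintro ⟨n, m⟩
    rw [Metric.dense_iff]
    intro f δ hδ
    obtain ⟨η, hη, hη1, hη2⟩ : ∃ η > 0, η ≤ 1 ∧ η * ‖(f : X →ᵇ ℝ)‖ ≤ δ / 4 := by
      have hp : 0 < ‖(f : X →ᵇ ℝ)‖ + 1 := by positivity
      refine ⟨min 1 (δ / 4 / (‖(f : X →ᵇ ℝ)‖ + 1)), by positivity, min_le_left _ _, ?_⟩
      calc _ ≤ (δ / 4 / (‖(f : X →ᵇ ℝ)‖ + 1)) * (‖(f : X →ᵇ ℝ)‖ + 1) := by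
            gcongr
            · exact min_le_right _ _
            · linarith
        _ = δ / 4 := by field_simp
    obtain ⟨g, hg1, hg2, hg3⟩ := approx (fun x => (1 - η) * (f : X →ᵇ ℝ) x) η hη
      (fun x y => by
        have := f.2 x y
        nlinarith) (δ / 4) (by positivity) n
    have hgl : LipschitzWith 1 g := LipschitzWith.of_le_add fun x y => by linarith [hg1 x y]
    have hclose : ∀ x, |g x - (f : X →ᵇ ℝ) x| ≤ δ / 2 := by
      intro x
      have h1 := hg2 x
      have h2 : |η * (f : X →ᵇ ℝ) x| ≤ δ / 4 := by
        rw [abs_mul, abs_of_pos hη]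
        refine le_trans ?_ hη2
        gcongr
        exact (f : X →ᵇ ℝ).norm_coe_le_norm x
      rw [abs_le] at *
      constructor <;> linarith [h1.1, h1.2, h2.1, h2.2]
    let G : X →ᵇ ℝ := BoundedContinuousFunction.ofNormedAddCommGroup g hgl.continuous
      (δ / 2 + ‖(f : X →ᵇ ℝ)‖) (fun x => by
        have h1 := hclose x
        have h2 := (f : X →ᵇ ℝ).norm_coe_le_norm x
        rw [Real.norm_eq_abs, abs_le] at *
        constructor <;> linarith [h1.1, h1.2, h2.1, h2.2])
    refine ⟨⟨G, hg1⟩, ?_, ?_⟩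
    · have : dist G f ≤ δ / 2 := (dist_le (by positivity)).2 fun x => hclose x
      exact lt_of_le_of_lt this (by linarith)
    · show ν (steep n 0 g)ᶜ < _
      rw [hg3.measure_zero]
      exact ENNReal.ofReal_pos.2 (by positivity)
  have : Nonempty L := ⟨⟨0, fun x y => by simp⟩⟩
  obtain ⟨f, hf⟩ := (dense_iInter_of_isOpen hopen hdense).nonempty
  rw [mem_iInter] at hf
  refine ⟨(f : X →ᵇ ℝ), LipschitzWith.of_le_add fun x y => by linarith [f.2 x y], fun n => ?_⟩
  by_contra hne
  have hpos : 0 < (ν (steep n 0 (f : X →ᵇ ℝ))ᶜ).toReal :=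
    ENNReal.toReal_pos hne (measure_ne_top _ _)
  obtain ⟨m, hm⟩ := exists_nat_one_div_lt hpos
  have h1 : ν (steep n 0 (f : X →ᵇ ℝ))ᶜ < ENNReal.ofReal (1 / ((m : ℝ) + 1)) := hf (n, m)
  have h2 := (ENNReal.lt_ofReal_iff_toReal_lt (measure_ne_top _ _)).1 h1
  linarith

/-- **There are no zero-dimensional charts of positive measure.**  Let `(X,d,μ)` be a metric
measure space and `U ⊆ X` Borel.  If every Lipschitz `f : X → ℝ` satisfies
`limsup_{x→x₀} |f(x)-f(x₀)|/d(x,x₀) = 0` for almost every `x₀ ∈ U`, then `μ(U) = 0`. -/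
theorem null_of_all_lipschitz_flat
    {X : Type*} [MetricSpace X] [CompleteSpace X] [TopologicalSpace.SeparableSpace X]
    [MeasurableSpace X] [BorelSpace X] (μ : Measure X) [IsFiniteMeasure μ]
    (hiso : μ {x : X | 𝓝[≠] x = ⊥} = 0)
    (U : Set X) (hU : MeasurableSet U)
    (h : ∀ f : X → ℝ, (∃ K : ℝ≥0, LipschitzWith K f) →
      ∀ᵐ x₀ ∂(μ.restrict U),
        Tendsto (fun x => |f x - f x₀| / dist x x₀) (𝓝[≠] x₀) (𝓝 0)) :
    μ U = 0 := by
  rcases isEmpty_or_nonempty X with hX | hX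
  · rw [eq_empty_of_isEmpty U, measure_empty]
  have hiso' : ∀ᵐ x ∂(μ.restrict U), ¬ (𝓝[≠] x = ⊥) := by
    refine ae_restrict_of_ae ?_
    rw [ae_iff]
    simpa using hiso
  have : NullSingletonClass (μ.restrict U) := by
    refine ⟨fun p => ?_⟩
    by_contra hp
    have hae : ∀ P : X → Prop, (∀ᵐ x ∂(μ.restrict U), P x) → P p := by
      intro P hP
      by_contra hnp
      exact hp (measure_mono_null (singleton_subset_iff.2 hnp) (ae_iff.1 hP))
    have h1 := hae _ hiso'
    have h2 := hae _ (h (fun x => dist x p) ⟨1, LipschitzWith.dist_left p⟩)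
    have : (𝓝[≠] p).NeBot := ⟨h1⟩
    have h3 : Tendsto (fun x => |dist x p - dist p p| / dist x p) (𝓝[≠] p) (𝓝 1) := by
      refine tendsto_const_nhds.congr' ?_
      filter_upwards [self_mem_nhdsWithin] with x hx
      have : 0 < dist x p := dist_pos.2 hx
      rw [dist_self, sub_zero, abs_of_pos this, div_self this.ne']
    exact zero_ne_one (tendsto_nhds_unique h2 h3)
  obtain ⟨f, hfL, hf⟩ := exists_steep (μ.restrict U)
  have hst : ∀ᵐ x ∂(μ.restrict U), ∀ n, x ∈ steep n 0 f := by
    rw [ae_all_iff]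
    intro n
    exact ae_iff.2 (hf n)
  have hfalse : ∀ᵐ x ∂(μ.restrict U), False := by
    filter_upwards [hst, h f ⟨1, hfL⟩] with x hx ht
    have hev := ht.eventually_lt_const (show (0 : ℝ) < 1 / 2 by norm_num)
    rw [eventually_nhdsWithin_iff, Metric.eventually_nhds_iff] at hev
    obtain ⟨ε, hε, hball⟩ := hev
    obtain ⟨n, hn⟩ := exists_nat_one_div_lt hε
    obtain ⟨y, h1, h2, h3⟩ := hx n
    have h4 := hball (y := y) (by rw [dist_comm]; linarith) (dist_pos.1 h1).symm
    rw [dist_comm y x, abs_sub_comm, div_lt_iff₀ h1] at h4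
    linarith
  have := ae_iff.1 hfalse
  simpa using this
end

section
/- Let Y be a measurable subset of a Lipschitz differentiability space (X,d,μ). Then (Y,d,μ⌞Y) is a Lipschitz differentiability space with respect to the restricted chart structure (i.e. the charts (Uᵢ ∩ Y, φᵢ|_Y) for a chart structure (Uᵢ,φᵢ) of X). Moreover, for any Lipschitz f: Y → ℝ, at μ-almost every point of Y the derivative of f with respect to these restricted charts agrees with the derivative of any Lipschitz extension of f to X. -/
open MeasureTheory Metric Filter Set Topology
open scoped ENNReal NNReal

lemma euclDot_add_left' {n : ℕ} (a a' b : EuclideanSpace ℝ (Fin n)) :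
    euclDot (a + a') b = euclDot a b + euclDot a' b := by
  simp [euclDot, add_mul, Finset.sum_add_distrib]

lemma euclDot_eq_inner {n : ℕ} (a b : EuclideanSpace ℝ (Fin n)) :
    euclDot a b = inner ℝ a b := by
  simp [euclDot, PiLp.inner_apply, mul_comm]

lemma porous_aux {X : Type*} [MetricSpace X] [MeasurableSpace X] [BorelSpace X]
    (ν : Measure X) [IsFiniteMeasure ν] (f : X → ℝ) (c : ℝ) (α : ℝ) (hα : 0 < α)
    (δ : ℝ≥0∞) (hδ : δ ≠ 0) :
    ∃ β, 0 < β ∧ β < α ∧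
      ν ({x | ∃ z, c * dist z x < f z ∧ 0 < f z ∧ f z < α} \
        {x | ∃ z, c * dist z x < f z ∧ β < f z ∧ f z < α}) < δ := by
  have hop : ∀ β, MeasurableSet {x | ∃ z, c * dist z x < f z ∧ β < f z ∧ f z < α} := by
    intro β
    apply IsOpen.measurableSet
    have : {x | ∃ z, c * dist z x < f z ∧ β < f z ∧ f z < α}
        = ⋃ z, {x | c * dist z x < f z ∧ β < f z ∧ f z < α} := by
      ext x; simp
    rw [this]
    refine isOpen_iUnion fun z => ?_
    have h1 : IsOpen {x | c * dist z x < f z} :=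
      isOpen_lt (by fun_prop) (by fun_prop)
    exact h1.inter isOpen_const
  set b : ℕ → ℝ := fun k => α / (k + 2) with hb
  have hlim : Tendsto (fun k : ℕ => ν ({x | ∃ z, c * dist z x < f z ∧ 0 < f z ∧ f z < α} \
        {x | ∃ z, c * dist z x < f z ∧ b k < f z ∧ f z < α})) atTop (𝓝 0) := by
    have hb0 : Tendsto b atTop (𝓝 0) := by
      apply Tendsto.const_div_atTop
      exact tendsto_atTop_add_const_right _ _ tendsto_natCast_atTop_atTop
    have := tendsto_measure_iInter_atTop (μ := ν)
      (s := fun k : ℕ => ({x | ∃ z, c * dist z x < f z ∧ 0 < f z ∧ f z < α} \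
        {x | ∃ z, c * dist z x < f z ∧ b k < f z ∧ f z < α}))
      (fun k => ((hop 0).diff (hop _)).nullMeasurableSet) ?_ ⟨0, measure_ne_top _ _⟩
    · have hemp : (⋂ k : ℕ, ({x | ∃ z, c * dist z x < f z ∧ 0 < f z ∧ f z < α} \
          {x | ∃ z, c * dist z x < f z ∧ b k < f z ∧ f z < α})) = ∅ := ?_
      · rw [hemp, measure_empty] at this
        exact this
      rw [eq_empty_iff_forall_notMem]
      intro x hx
      simp only [mem_iInter, mem_diff, mem_setOf_eq] at hx
      obtain ⟨z, h1, h2, h3⟩ := (hx 0).1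
      obtain ⟨k, hk⟩ := (hb0.eventually (gt_mem_nhds h2)).exists
      exact (hx k).2 ⟨z, h1, hk, h3⟩
    · intro k l hkl x hx
      refine ⟨hx.1, fun ⟨z, h1, h2, h3⟩ => hx.2 ⟨z, h1, lt_of_le_of_lt ?_ h2, h3⟩⟩
      simp only [hb]
      gcongr
  obtain ⟨k, hk⟩ := (hlim.eventually (gt_mem_nhds (pos_iff_ne_zero.mpr hδ))).exists
  refine ⟨b k, by positivity, ?_, hk⟩
  simp only [hb]
  rw [div_lt_iff₀ (by positivity)]
  have : (0:ℝ) ≤ k := by positivity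
  nlinarith

lemma porous_null_s14 {X : Type*} [MetricSpace X] [MeasurableSpace X] [BorelSpace X]
    (ν : Measure X) [IsFiniteMeasure ν] (Y : Set X) {n : ℕ}
    (φ : X → EuclideanSpace ℝ (Fin n))
    (hdiff : ∀ f : X → ℝ, (∃ K : ℝ≥0, LipschitzWith K f) → ∀ᵐ x ∂ν, ∃ D, DiffAt f φ x D)
    (c : ℝ) (hc : 0 < c) :
    ∀ᵐ x ∂ν, x ∈ Y → ∃ α > 0, ∀ z, 0 < infDist z Y → infDist z Y < α →
      infDist z Y ≤ c * dist z x := by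
  set f : X → ℝ := fun z => infDist z Y with hf
  have hfl : LipschitzWith 1 f := lipschitz_infDist_pt Y
  have hex : ∀ (α : ℝ) (j : ℕ), ∃ β, 0 < α → 0 < β ∧ β < α ∧
      ν ({x | ∃ z, c * dist z x < f z ∧ 0 < f z ∧ f z < α} \
        {x | ∃ z, c * dist z x < f z ∧ β < f z ∧ f z < α}) < (2⁻¹ : ℝ≥0∞) ^ j := by
    intro α j
    by_cases hα : 0 < α
    · obtain ⟨β, h⟩ := porous_aux ν f c α hα ((2⁻¹ : ℝ≥0∞) ^ j) (by simp)
      exact ⟨β, fun _ => h⟩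
    · exact ⟨0, fun h => absurd h hα⟩
  choose b hb using hex
  let α : ℕ → ℝ := fun j => Nat.rec 1 (fun j a => b a j / 2) j
  have hα1 : ∀ j, α (j + 1) = b (α j) j / 2 := fun j => rfl
  have hαpos : ∀ j, 0 < α j := by
    intro j
    induction j with
    | zero => exact one_pos
    | succ j ih => rw [hα1]; have := (hb _ j ih).1; positivity
  set β : ℕ → ℝ := fun j => b (α j) j with hβ
  have hβpos : ∀ j, 0 < β j := fun j => (hb _ j (hαpos j)).1
  have hβα : ∀ j, β j < α j := fun j => (hb _ j (hαpos j)).2.1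
  have hα2 : ∀ j, α (j + 1) = β j / 2 := fun j => rfl
  have hanti : Antitone α := antitone_nat_of_succ_le fun j => by
    rw [hα2]; linarith [hβα j, hβpos j]
  have hsep : ∀ i j, i < j → α j ≤ β i / 2 := fun i j hij => by
    rw [← hα2]; exact hanti hij
  have hαpow : ∀ j, α j ≤ (1 / 2 : ℝ) ^ j := by
    intro j
    induction j with
    | zero => simp [α]
    | succ j ih => rw [hα2, pow_succ]; linarith [hβα j]
  have hBC : ∀ᵐ x ∂ν, ∀ᶠ j in atTop, x ∉
      ({x | ∃ z, c * dist z x < f z ∧ 0 < f z ∧ f z < α j} \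
        {x | ∃ z, c * dist z x < f z ∧ β j < f z ∧ f z < α j}) := by
    apply ae_eventually_notMem
    refine ne_top_of_le_ne_top ?_ (ENNReal.tsum_le_tsum fun j => (hb _ j (hαpos j)).2.2.le)
    rw [ENNReal.tsum_geometric]
    simp
  let Z : Fin (n + 1) → Set ℝ := fun p =>
    {0} ∪ {t | ∃ j : ℕ, j % (n + 1) ≠ p ∧ t ∈ Icc (β j) (α j)}
  let h : Fin (n + 1) → X → ℝ := fun p x => infDist (f x) (Z p)
  have hh : ∀ p, LipschitzWith 1 (h p) := fun p => by
    have := (lipschitz_infDist_pt (Z p)).comp hfl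
    rw [one_mul] at this
    exact this
  have hD : ∀ᵐ x ∂ν, ∀ p, ∃ D, DiffAt (h p) φ x D := by
    rw [ae_all_iff]
    exact fun p => hdiff _ ⟨1, hh p⟩
  filter_upwards [hBC, hD] with x hx hDx hxY
  by_contra hcon
  push Not at hcon
  choose D hD using hDx
  have hfx : f x = 0 := infDist_zero_of_mem hxY
  have hhx : ∀ p, h p x = 0 := fun p => by
    show infDist (f x) (Z p) = 0
    rw [hfx]; exact infDist_zero_of_mem (Or.inl rfl)
  have hnl : ¬ LinearIndependent ℝ D := by
    intro hl
    have := hl.fintype_card_le_finrank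
    simp at this
  obtain ⟨w, hw, q, hq⟩ := Fintype.not_linearIndependent_iff.mp hnl
  have hsum : Tendsto (fun z => ∑ p, |w p| *
      (|h p z - h p x - euclDot (D p) (φ z - φ x)| / dist z x)) (𝓝[≠] x) (𝓝 0) := by
    have : (0:ℝ) = ∑ p, |w p| * 0 := by simp
    rw [this]
    exact tendsto_finsetSum _ fun p _ => (hD p).const_mul _
  have hev := hsum.eventually (gt_mem_nhds (show 0 < |w q| * (c / 2) by positivity))
  rw [eventually_nhdsWithin_iff, Metric.eventually_nhds_iff] at hev
  obtain ⟨δ, hδ, hev⟩ := hev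
  obtain ⟨M, hM⟩ := eventually_atTop.mp hx
  obtain ⟨N, hN⟩ := exists_pow_lt_of_lt_one (show 0 < c * δ by positivity)
    (show (1 / 2 : ℝ) < 1 by norm_num)
  set j := (n + 1) * (M + N) + q with hj
  have hjM : M + N ≤ j := by nlinarith [Nat.zero_le (n * (M + N)), Nat.zero_le (q : ℕ)]
  have hjq : j % (n + 1) = q := by
    rw [hj, Nat.mul_add_mod]; exact Nat.mod_eq_of_lt q.2
  have hjx := hM j (by omega)
  obtain ⟨z0, h01, h02, h03⟩ := hcon (α j) (hαpos j)
  have hz : ∃ z, c * dist z x < f z ∧ β j < f z ∧ f z < α j := by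
    refine Classical.byContradiction fun hno => ?_
    exact hjx ⟨⟨z0, h03, h01, h02⟩, hno⟩
  obtain ⟨z, hz1, hz2, hz3⟩ := hz
  have hzx : z ≠ x := by
    rintro rfl
    rw [hfx] at hz2
    linarith [hβpos j]
  have hd : 0 < dist z x := dist_pos.mpr hzx
  have hzδ : dist z x < δ := by
    have : α j ≤ (1 / 2 : ℝ) ^ N := (hαpow j).trans
      (pow_le_pow_of_le_one (by norm_num) (by norm_num) (by omega))
    have : c * dist z x < c * δ := by linarith
    exact lt_of_mul_lt_mul_left this hc.le
  have hlt := hev hzδ hzx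
  have hp0 : ∀ p, p ≠ q → h p z = 0 := by
    intro p hp
    apply infDist_zero_of_mem
    refine Or.inr ⟨j, ?_, hz2.le, hz3.le⟩
    rw [hjq]
    exact fun h => hp (Fin.ext h.symm)
  have hpq : f z / 2 ≤ h q z := by
    refine (le_infDist (s := Z q) ⟨(0 : ℝ), Or.inl rfl⟩).mpr ?_
    intro t ht
    rcases ht with ht | ⟨i, hi, ht1, ht2⟩
    · rw [mem_singleton_iff.mp ht, Real.dist_eq, sub_zero]
      linarith [le_abs_self (f z), hβpos j]
    · rw [Real.dist_eq]
      have hij : i ≠ j := by rintro rfl; exact hi hjq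
      rcases lt_or_gt_of_ne hij with hij | hij
      · have := hsep i j hij
        linarith [neg_abs_le (f z - t), hβpos i]
      · have := hsep j i hij
        linarith [le_abs_self (f z - t), hβpos i]
  have hdot : ∑ p, w p * euclDot (D p) (φ z - φ x) = 0 := by
    have : inner ℝ (∑ p, w p • D p) (φ z - φ x) = 0 := by rw [hw, inner_zero_left]
    rw [sum_inner] at this
    simpa [euclDot_eq_inner, inner_smul_left] using this
  have hcomb : ∑ p, w p * (h p z - h p x - euclDot (D p) (φ z - φ x)) = w q * h q z := by
    simp only [mul_sub, Finset.sum_sub_distrib, hdot, hhx]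
    simp only [mul_zero, Finset.sum_const_zero, sub_zero]
    exact Finset.sum_eq_single q (fun p _ hp => by rw [hp0 p hp, mul_zero]) (by simp)
  have hle : |w q| * h q z / dist z x ≤ ∑ p, |w p| *
      (|h p z - h p x - euclDot (D p) (φ z - φ x)| / dist z x) := by
    have h1 : |w q * h q z| ≤ ∑ p, |w p| * |h p z - h p x - euclDot (D p) (φ z - φ x)| := by
      rw [← hcomb]
      refine (Finset.abs_sum_le_sum_abs _ _).trans (le_of_eq ?_)
      simp only [abs_mul]
    have h2 : |h q z| = h q z := abs_of_nonneg infDist_nonneg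
    rw [abs_mul, h2] at h1
    calc _ ≤ (∑ p, |w p| * |h p z - h p x - euclDot (D p) (φ z - φ x)|) / dist z x := by gcongr
      _ = _ := by rw [Finset.sum_div]; simp only [mul_div_assoc]
  have hge : |w q| * (c / 2) ≤ |w q| * h q z / dist z x := by
    rw [le_div_iff₀ hd, mul_assoc]
    refine mul_le_mul_of_nonneg_left ?_ (abs_nonneg _)
    linarith
  linarith

lemma diffAt_restrict {X : Type*} [MetricSpace X] {Y : Set X} {n : ℕ}
    {φ : X → EuclideanSpace ℝ (Fin n)} {F : X → ℝ} {g : Y → ℝ}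
    (hFg : ∀ y : Y, F (y : X) = g y) (y : Y) (D : EuclideanSpace ℝ (Fin n))
    (h : DiffAt F φ (y : X) D) : DiffAt g (fun z : Y => φ (z : X)) y D := by
  have ht : Tendsto (Subtype.val : Y → X) (𝓝[≠] y) (𝓝[≠] (y : X)) := by
    refine tendsto_nhdsWithin_of_tendsto_nhds_of_eventually_within _
      (continuous_subtype_val.continuousAt.mono_left nhdsWithin_le_nhds) ?_
    filter_upwards [self_mem_nhdsWithin] with z hz h
    exact hz (Subtype.ext h)
  have := Tendsto.comp h ht
  refine this.congr fun z => ?_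
  simp [hFg, Subtype.dist_eq]

lemma unique_transfer {X : Type*} [MetricSpace X] {Y : Set X} {n : ℕ}
    {φ : X → EuclideanSpace ℝ (Fin n)} {K : ℝ≥0} (hφ : LipschitzWith K φ) {g : Y → ℝ} (y : Y)
    (hpor : ∀ k : ℕ, ∃ α > 0, ∀ z, 0 < infDist z Y → infDist z Y < α →
      infDist z Y ≤ (1 / ((k : ℝ) + 1)) * dist z (y : X))
    (huniq : ∃! D, DiffAt (fun _ : X => (0 : ℝ)) φ (y : X) D)
    (D D' : EuclideanSpace ℝ (Fin n))
    (h : DiffAt g (fun z : Y => φ (z : X)) y D) (h' : DiffAt g (fun z : Y => φ (z : X)) y D') :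
    D = D' := by
  have hsub : ∀ v, euclDot (D - D') v = euclDot D v - euclDot D' v := fun v => by
    simp [euclDot_eq_inner, inner_sub_left]
  have h0 : DiffAt (fun _ : X => (0 : ℝ)) φ (y : X) 0 := by
    simp [DiffAt, euclDot, tendsto_const_nhds]
  suffices hE : DiffAt (fun _ : X => (0 : ℝ)) φ (y : X) (D - D') from
    sub_eq_zero.mp (huniq.unique hE h0)
  have hY : ∀ ε > 0, ∃ δ > 0, ∀ z : Y, dist (z : X) y < δ →
      |euclDot (D - D') (φ z - φ y)| ≤ ε * dist (z : X) y := by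
    intro ε hε
    have hs := (h.add h').eventually (gt_mem_nhds (show (0 : ℝ) + 0 < ε by linarith))
    rw [eventually_nhdsWithin_iff, Metric.eventually_nhds_iff] at hs
    obtain ⟨δ, hδ, hs⟩ := hs
    refine ⟨δ, hδ, fun z hz => ?_⟩
    by_cases hzy : z = y
    · subst hzy; simp [euclDot]
    · have h1 := hs (y := z) hz hzy
      have hd : 0 < dist z y := dist_pos.mpr hzy
      rw [← add_div, div_lt_iff₀ hd] at h1
      rw [hsub]
      refine le_trans ?_ h1.le
      have := abs_sub (g z - g y - euclDot D' (φ z - φ y)) (g z - g y - euclDot D (φ z - φ y))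
      rw [show (g z - g y - euclDot D' (φ z - φ y)) - (g z - g y - euclDot D (φ z - φ y))
        = euclDot D (φ z - φ y) - euclDot D' (φ z - φ y) by ring] at this
      linarith
  set L : ℝ := ‖D - D'‖ * K with hL
  have hL0 : 0 ≤ L := by positivity
  unfold DiffAt
  rw [Metric.tendsto_nhds]
  intro ε hε
  obtain ⟨k, hk⟩ := exists_nat_one_div_lt (show 0 < min 1 (ε / (4 * (L + 1))) by positivity)
  set η := min 1 (ε / (4 * (L + 1))) with hη
  have hη0 : 0 < η := by positivity
  have hη1 : η ≤ 1 := min_le_left _ _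
  have hη2 : L * η ≤ ε / 4 := by
    have : η ≤ ε / (4 * (L + 1)) := min_le_right _ _
    rw [le_div_iff₀ (by positivity)] at this
    nlinarith
  obtain ⟨α, hα, hp⟩ := hpor k
  obtain ⟨δ, hδ, hY⟩ := hY (ε / 4) (by positivity)
  rw [eventually_nhdsWithin_iff, Metric.eventually_nhds_iff]
  refine ⟨min α (δ / 2), by positivity, fun z hz hzy => ?_⟩
  have hd : 0 < dist z (y : X) := dist_pos.mpr hzy
  have hzα := hz.trans_le (min_le_left _ _)
  have hzδ := hz.trans_le (min_le_right _ _)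
  have hinf : infDist z Y < η * dist z y := by
    rcases (infDist_nonneg (x := z) (s := Y)).eq_or_lt with h0 | h0
    · rw [← h0]; positivity
    · refine (hp z h0 ((infDist_le_dist_of_mem y.2).trans_lt hzα)).trans_lt ?_
      gcongr
  obtain ⟨z', hz'Y, hz'⟩ := (infDist_lt_iff (s := Y) ⟨(y : X), y.2⟩).mp hinf
  have hz'y : dist z' (y : X) ≤ 2 * dist z y := by
    have := dist_triangle z' z (y : X)
    rw [dist_comm z' z] at this
    nlinarith
  have e1 := hY ⟨z', hz'Y⟩ (by simp only; linarith)
  simp only at e1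
  have e2 : |euclDot (D - D') (φ z - φ z')| ≤ L * dist z z' := by
    rw [euclDot_eq_inner]
    refine (abs_real_inner_le_norm _ _).trans ?_
    rw [hL, mul_assoc]
    gcongr
    rw [← dist_eq_norm]
    exact hφ.dist_le_mul _ _
  have e3 : euclDot (D - D') (φ z - φ y) =
      euclDot (D - D') (φ z - φ z') + euclDot (D - D') (φ z' - φ y) := by
    simp only [euclDot_eq_inner, ← inner_add_right]
    congr 1; abel
  have e4 : L * dist z z' ≤ ε / 4 * dist z y := by
    calc L * dist z z' ≤ L * (η * dist z y) := by gcongr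
      _ = (L * η) * dist z y := by ring
      _ ≤ _ := by gcongr
  rw [Real.dist_eq, sub_zero, abs_div, abs_abs, abs_of_pos hd, div_lt_iff₀ hd]
  simp only [sub_self, zero_sub, abs_neg]
  rw [e3]
  have e5 := abs_add_le (euclDot (D - D') (φ z - φ z')) (euclDot (D - D') (φ z' - φ y))
  have e6 : ε / 4 * dist z' (y : X) ≤ ε / 4 * (2 * dist z y) := by gcongr
  have : 0 < ε * dist z y := by positivity
  linarith

lemma ae_comap_aux {X : Type*} [MeasurableSpace X] (μ : Measure X) {Y U : Set X}
    (hY : MeasurableSet Y) (hU : MeasurableSet U) {P : Y → Prop} {Q : X → Prop}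
    (hQ : ∀ᵐ x ∂(μ.restrict U), Q x) (hQP : ∀ y : Y, Q y → P y) :
    ∀ᵐ (y : Y) ∂((μ.comap (Subtype.val : Y → X)).restrict {y : Y | (y : X) ∈ U}), P y := by
  have hm : MeasurableSet {y : Y | (y : X) ∈ U} := measurable_subtype_coe hU
  rw [ae_restrict_iff' hm, ae_iff, (MeasurableEmbedding.subtype_coe hY).comap_apply]
  rw [ae_restrict_iff' hU, ae_iff] at hQ
  refine measure_mono_null ?_ hQ
  rintro _ ⟨y, hy, rfl⟩ h
  exact hy fun hu => hQP y (h hu)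

/-- **Measurable subsets of Lipschitz differentiability spaces.**  Let `(Uᵢ,φᵢ)` be a chart
structure of a Lipschitz differentiability space `(X,d,μ)` and let `Y ⊆ X` be measurable.
Then `(Y,d,μ⌞Y)` is a Lipschitz differentiability space with respect to the restricted charts
`(Uᵢ ∩ Y, φᵢ|_Y)`; moreover the derivative of a Lipschitz `g : Y → ℝ` agrees almost everywhere
with the derivative of any Lipschitz extension of `g` to `X`. -/
theorem subset_lds
    {X : Type*} [MetricSpace X] [CompleteSpace X] [TopologicalSpace.SeparableSpace X]
    [MeasurableSpace X] [BorelSpace X] (μ : Measure X) [IsFiniteMeasure μ]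
    (hiso : μ {x : X | 𝓝[≠] x = ⊥} = 0)
    (Y : Set X) (hY : MeasurableSet Y)
    (n : ℕ → ℕ) (U : ℕ → Set X) (φ : ∀ i, X → EuclideanSpace ℝ (Fin (n i)))
    (hU : ∀ i, MeasurableSet (U i)) (hcover : (⋃ i, U i) = univ)
    (hφ : ∀ i, ∃ K : ℝ≥0, LipschitzWith K (φ i))
    (hdiff : ∀ f : X → ℝ, (∃ K : ℝ≥0, LipschitzWith K f) →
      ∀ i, ∀ᵐ x ∂(μ.restrict (U i)), ∃! D, DiffAt f (φ i) x D) :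
    (∀ g : Y → ℝ, (∃ K : ℝ≥0, LipschitzWith K g) →
      ∀ i, ∀ᵐ (y : Y) ∂((μ.comap (Subtype.val : Y → X)).restrict {y : Y | (y : X) ∈ U i}),
        ∃! D, DiffAt g (fun z : Y => φ i (z : X)) y D) ∧
    ∀ g : Y → ℝ, (∃ K : ℝ≥0, LipschitzWith K g) →
      ∀ F : X → ℝ, (∃ K : ℝ≥0, LipschitzWith K F) → (∀ y : Y, F (y : X) = g y) →
        ∀ i, ∀ᵐ (y : Y) ∂((μ.comap (Subtype.val : Y → X)).restrict {y : Y | (y : X) ∈ U i}),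
          ∀ D, DiffAt F (φ i) (Subtype.val y) D → DiffAt g (fun z : Y => φ i (z : X)) y D := by
  refine ⟨?_, ?_⟩
  · rintro g ⟨K, hg⟩ i
    obtain ⟨Kφ, hKφ⟩ := hφ i
    obtain ⟨F, hF, hFg⟩ : ∃ F : X → ℝ, LipschitzWith K F ∧ ∀ y : Y, F (y : X) = g y := by
      classical
      let g' : X → ℝ := fun x => if hx : x ∈ Y then g ⟨x, hx⟩ else 0
      have hg' : LipschitzOnWith K g' Y := by
        rw [lipschitzOnWith_iff_restrict]
        convert hg using 1
        ext y
        simp [g']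
      obtain ⟨F, hF, hFg⟩ := hg'.extend_real
      refine ⟨F, hF, fun y => ?_⟩
      rw [← hFg y.2]
      simp [g']
    have h1 := hdiff F ⟨K, hF⟩ i
    have h2 := hdiff (fun _ => 0) ⟨0, LipschitzWith.const 0⟩ i
    have h3 : ∀ᵐ x ∂(μ.restrict (U i)), ∀ k : ℕ, x ∈ Y → ∃ α > 0, ∀ z, 0 < infDist z Y →
        infDist z Y < α → infDist z Y ≤ (1 / ((k : ℝ) + 1)) * dist z x := by
      rw [ae_all_iff]
      intro k
      exact porous_null_s14 (μ.restrict (U i)) Y (φ i)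
        (fun f hf => (hdiff f hf i).mono fun x hx => hx.exists) _ (by positivity)
    refine ae_comap_aux μ hY (hU i) (h1.and (h2.and h3)) ?_
    rintro y ⟨⟨D, hD, -⟩, hu, hp⟩
    have hD' := diffAt_restrict hFg y D hD
    exact ⟨D, hD', fun D' h' => unique_transfer hKφ y (fun k => hp k y.2) hu D' D h' hD'⟩
  · intro g _ F _ hFg i
    exact Eventually.of_forall fun y D hD => diffAt_restrict hFg y D hD
end
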